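/- For every rational number σ > 0, there exists an oracle Turing machine f such that for all C-independent infinite binary sequences x and y with dim(x) ≥ σ and dim(y) ≥ σ, the machine f with oracle the join x ⊕ y computes a total infinite binary sequence f(x,y) with dim(f(x,y)) = 1. -/

import Mathlib

/-- Binary strings. -/
abbrev Str := List Bool

/-- `U` is an optimal universal conditional machine: it is partial computable and,
for every partial computable `M`, programs for `M` can be translated to programs
for `U` with only a constant-length overhead. -/
def UniversalM (U : Str × Str →. Str) : Prop :=
  Partrec U ∧
    ∀ M : Str × Str →. Str, Partrec M →
      ∃ c : ℕ, ∀ x y p : Str, x ∈ M (p, y) →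
        ∃ q : Str, x ∈ U (q, y) ∧ q.length ≤ p.length + c

/-- Conditional plain Kolmogorov complexity `C(x|y)` with respect to `U`. -/
noncomputable def KC (U : Str × Str →. Str) (x y : Str) : ℕ :=
  sInf {l : ℕ | ∃ p : Str, p.length = l ∧ x ∈ U (p, y)}

/-- Unconditional plain complexity `C(x) = C(x|λ)`. -/
noncomputable def KC0 (U : Str × Str →. Str) (x : Str) : ℕ := KC U x []

/-- Complexity conditioned on (the binary representation of) a natural number. -/
noncomputable def KCn (U : Str × Str →. Str) (x : Str) (n : ℕ) : ℕ := KC U x (Nat.bits n)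

/-- The length-`n` prefix of an infinite binary sequence. -/
def pre (x : ℕ → Bool) (n : ℕ) : Str := List.ofFn (fun i : Fin n => x i)

/-- `Φ` is (the finite-use functional of) an oracle Turing machine that, with oracle
`A`, totally computes the sequence `B`: answers obtained from finite prefixes of `A`
are consistent, and every bit of `B` is obtained from some finite prefix of `A`. -/
def TuringComputes (Φ : Str → ℕ →. Bool) (A B : ℕ → Bool) : Prop :=
  (∀ (n m₁ m₂ : ℕ) (b₁ b₂ : Bool),
      b₁ ∈ Φ (pre A m₁) n → b₂ ∈ Φ (pre A m₂) n → b₁ = b₂) ∧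
  (∀ n, ∃ m, B n ∈ Φ (pre A m) n)

/-- `B` is Turing-reducible to `A`. -/
def TuringLE (B A : ℕ → Bool) : Prop :=
  ∃ Φ : Str → ℕ →. Bool, Partrec₂ Φ ∧ TuringComputes Φ A B

/-- The effective Hausdorff dimension of a sequence: `liminf C(x↾n)/n`. -/
noncomputable def dimOf (U : Str × Str →. Str) (x : ℕ → Bool) : ℝ :=
  Filter.liminf (fun n : ℕ => (KC0 U (pre x n) : ℝ) / (n : ℝ)) Filter.atTop

/-- The effective packing dimension of a sequence: `limsup C(x↾n)/n`. -/
noncomputable def DimOf (U : Str × Str →. Str) (x : ℕ → Bool) : ℝ :=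
  Filter.limsup (fun n : ℕ => (KC0 U (pre x n) : ℝ) / (n : ℝ)) Filter.atTop

/-- Sequences `x` and `y` are C-independent: the complexity of the concatenation of
any two prefixes is at least the sum of their complexities, up to logarithmic terms. -/
def CIndependent (U : Str × Str →. Str) (x y : ℕ → Bool) : Prop :=
  ∃ c : ℝ, ∀ n m : ℕ,
    (KC0 U (pre x n) : ℝ) + (KC0 U (pre y m) : ℝ)
        - c * (Real.logb 2 n + Real.logb 2 m) - c
      ≤ (KC0 U (pre x n ++ pre y m) : ℝ)

/-- The join `x ⊕ y` of two sequences. -/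
def join (x y : ℕ → Bool) : ℕ → Bool :=
  fun n => if n % 2 = 0 then x (n / 2) else y (n / 2)

theorem Primrec.nat_pow : Primrec₂ ((· ^ ·) : ℕ → ℕ → ℕ) :=
  Primrec₂.unpaired'.1 Nat.Primrec.pow

theorem Primrec.nat_testBit : Primrec₂ Nat.testBit := by
  have h : PrimrecPred fun p : ℕ × ℕ => p.1 / 2 ^ p.2 % 2 = 1 :=
    Primrec.eq.comp (Primrec.nat_mod.comp (Primrec.nat_div.comp Primrec.fst
      (Primrec.nat_pow.comp (Primrec.const 2) Primrec.snd)) (Primrec.const 2)) (Primrec.const 1)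
  exact h.decide.of_eq fun p => (Nat.testBit_eq_decide_div_mod_eq).symm

theorem PrimrecPred.forall_lt_comp {α : Type*} [Primcodable α] {R : α × ℕ → Prop} {f : α → ℕ}
    (hR : PrimrecPred R) (hf : Primrec f) : PrimrecPred fun a => ∀ j < f a, R (a, j) :=
  PrimrecPred.of_eq ((PrimrecRel.forall_mem_list (R := fun (j : ℕ) (a : α) => R (a, j))
    (hR.comp (Primrec.pair Primrec.snd Primrec.fst))).comp (Primrec.list_range.comp hf)
    Primrec.id) fun a => by simp

theorem PrimrecPred.exists_lt_comp {α : Type*} [Primcodable α] {R : α × ℕ → Prop} {f : α → ℕ}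
    (hR : PrimrecPred R) (hf : Primrec f) : PrimrecPred fun a => ∃ j < f a, R (a, j) :=
  PrimrecPred.of_eq ((PrimrecRel.exists_mem_list (R := fun (j : ℕ) (a : α) => R (a, j))
    (hR.comp (Primrec.pair Primrec.snd Primrec.fst))).comp (Primrec.list_range.comp hf)
    Primrec.id) fun a => by simp

theorem Primrec.sum_range {α : Type*} [Primcodable α] {g : α × ℕ → ℕ} {f : α → ℕ}
    (hg : Primrec g) (hf : Primrec f) : Primrec fun a => ∑ j ∈ Finset.range (f a), g (a, j) := by
  have := Primrec.nat_rec' (f := f) (g := fun _ : α => 0)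
    (h := fun a p => p.2 + g (a, p.1)) hf (Primrec.const 0)
    (Primrec.nat_add.comp (Primrec.snd.comp Primrec.snd)
      (hg.comp (Primrec.pair Primrec.fst (Primrec.fst.comp Primrec.snd))))
  refine this.of_eq fun a => ?_
  induction f a with
  | zero => rfl
  | succ n ih => rw [Finset.sum_range_succ, ← ih]

/-- The string consisting of the `n` low-order binary digits of `v`. -/
def lowBits (n v : ℕ) : Str := (List.range n).map fun i => v.testBit i

/-- The number whose binary digits, least significant first, are the bits of `s`. -/
def strVal (s : Str) : ℕ := s.foldr (fun b n => b.toNat + 2 * n) 0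

theorem primrec_lowBits : Primrec₂ lowBits :=
  Primrec.list_map (Primrec.list_range.comp Primrec.fst)
    (Primrec.nat_testBit.comp (Primrec.snd.comp Primrec.fst) Primrec.snd)

theorem primrec_strVal : Primrec strVal :=
  Primrec.list_foldr (h := fun _ (p : Bool × ℕ) => p.1.toNat + 2 * p.2) Primrec.id (Primrec.const 0)
    (Primrec.nat_add.comp ((Primrec.dom_bool Bool.toNat).comp (Primrec.fst.comp Primrec.snd))
      (Primrec.nat_mul.comp (Primrec.const 2) (Primrec.snd.comp Primrec.snd)))

@[simp] theorem length_lowBits (n v : ℕ) : (lowBits n v).length = n := by simp [lowBits]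

theorem strVal_lt (s : Str) : strVal s < 2 ^ s.length := by
  induction s with
  | nil => simp [strVal]
  | cons b s ih =>
    have : strVal (b :: s) = b.toNat + 2 * strVal s := rfl
    have hb : b.toNat ≤ 1 := Bool.toNat_le b
    rw [this, List.length_cons, pow_succ]
    omega

theorem testBit_strVal (s : Str) (i : ℕ) : (strVal s).testBit i = s.getD i false := by
  induction s generalizing i with
  | nil => simp [strVal]
  | cons b s ih =>
    have h : strVal (b :: s) = Nat.bit b (strVal s) := by
      change b.toNat + 2 * strVal s = _
      cases b <;> simp [Nat.bit] ; omega
    rw [h]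
    cases i with
    | zero => simp
    | succ i => simp [Nat.testBit_bit_succ, ih]

theorem lowBits_strVal (s : Str) : lowBits s.length (strVal s) = s := by
  apply List.ext_getElem
  · simp
  · intro i h₁ h₂
    simp [lowBits, testBit_strVal, h₂]

theorem strVal_injOn_length {s t : Str} (hl : s.length = t.length) (h : strVal s = strVal t) :
    s = t := by
  rw [← lowBits_strVal s, ← lowBits_strVal t, hl, h]

@[simp] theorem strVal_lowBits (n v : ℕ) : strVal (lowBits n v) = v % 2 ^ n := by
  apply Nat.eq_of_testBit_eq
  intro i
  rw [testBit_strVal, Nat.testBit_mod_two_pow]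
  by_cases h : i < n <;> simp [lowBits, h]

theorem lowBits_mod {m n : ℕ} (h : m ≤ n) (v : ℕ) : lowBits m (v % 2 ^ n) = lowBits m v := by
  apply List.map_congr_left
  intro i hi
  rw [List.mem_range] at hi
  rw [Nat.testBit_mod_two_pow]
  simp; omega

/-- Predicates that are projections of primitive recursive relations. -/
def SigmaOne {α : Type*} [Primcodable α] (R : α → Prop) : Prop :=
  ∃ D : α → ℕ → Bool, Primrec₂ D ∧ ∀ a, R a ↔ ∃ k, D a k = true

namespace SigmaOne

variable {α β : Type*} [Primcodable α] [Primcodable β]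

theorem of_eq {R S : α → Prop} (hR : SigmaOne R) (h : ∀ a, R a ↔ S a) : SigmaOne S := by
  rwa [← funext fun a => propext (h a)]

theorem of_primrecPred {R : α → Prop} (hR : PrimrecPred R) : SigmaOne R := by
  obtain ⟨_, h⟩ := hR
  exact ⟨fun a _ => decide (R a), h.comp Primrec.fst, fun a => by simp⟩

theorem comp {R : β → Prop} (hR : SigmaOne R) {f : α → β} (hf : Primrec f) :
    SigmaOne fun a => R (f a) := by
  obtain ⟨D, hD, h⟩ := hR
  exact ⟨fun a k => D (f a) k, hD.comp (hf.comp Primrec.fst) Primrec.snd, fun a => h _⟩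

theorem and {R S : α → Prop} (hR : SigmaOne R) (hS : SigmaOne S) :
    SigmaOne fun a => R a ∧ S a := by
  obtain ⟨D, hD, h⟩ := hR
  obtain ⟨E, hE, h'⟩ := hS
  refine ⟨fun a k => D a k.unpair.1 && E a k.unpair.2, ?_, fun a => ?_⟩
  · exact Primrec.and.comp
      (hD.comp Primrec.fst (Primrec.fst.comp (Primrec.unpair.comp Primrec.snd)))
      (hE.comp Primrec.fst (Primrec.snd.comp (Primrec.unpair.comp Primrec.snd)))
  · beta_reduce
    rw [h, h']
    constructor
    · rintro ⟨⟨i, hi⟩, ⟨j, hj⟩⟩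
      exact ⟨Nat.pair i j, by simp [hi, hj]⟩
    · rintro ⟨k, hk⟩
      simp only [Bool.and_eq_true] at hk
      exact ⟨⟨_, hk.1⟩, ⟨_, hk.2⟩⟩

theorem ex {R : α × β → Prop} (hR : SigmaOne R) : SigmaOne fun a => ∃ b, R (a, b) := by
  obtain ⟨D, hD, h⟩ := hR
  refine ⟨fun a k => Option.casesOn (Encodable.decode (α := β) k.unpair.1) false
    (fun b => D (a, b) k.unpair.2), ?_, fun a => ?_⟩
  · exact Primrec.option_casesOn
      (Primrec.decode.comp (Primrec.fst.comp (Primrec.unpair.comp Primrec.snd)))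
      (Primrec.const false)
      (hD.comp (Primrec.pair (Primrec.fst.comp Primrec.fst) Primrec.snd)
        (Primrec.snd.comp (Primrec.unpair.comp (Primrec.snd.comp Primrec.fst))))
  · constructor
    · rintro ⟨b, hb⟩
      obtain ⟨k, hk⟩ := (h _).1 hb
      exact ⟨Nat.pair (Encodable.encode b) k, by simpa using hk⟩
    · rintro ⟨k, hk⟩
      cases hd : (Encodable.decode (α := β) k.unpair.1) with
      | none => simp [hd] at hk
      | some b =>
        simp only [hd] at hk
        exact ⟨b, (h _).2 ⟨_, hk⟩⟩

theorem ball_lt {R : α × ℕ → Prop} (hR : SigmaOne R) {f : α → ℕ} (hf : Primrec f) :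
    SigmaOne fun a => ∀ j < f a, R (a, j) := by
  obtain ⟨D, hD, h⟩ := hR
  have hD' : PrimrecPred fun p : ((α × ℕ) × ℕ) × ℕ => D (p.1.1.1, p.1.2) p.2 = true :=
    Primrec.eq.comp (hD.comp (Primrec.pair
      (Primrec.fst.comp (Primrec.fst.comp Primrec.fst)) (Primrec.snd.comp Primrec.fst))
      Primrec.snd) (Primrec.const true)
  have h₁ : PrimrecPred fun p : (α × ℕ) × ℕ => ∃ k < p.1.2, D (p.1.1, p.2) k = true :=
    hD'.exists_lt_comp (f := fun p : (α × ℕ) × ℕ => p.1.2) (Primrec.snd.comp Primrec.fst)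
  have h₂ : PrimrecPred fun p : α × ℕ => ∀ j < f p.1, ∃ k < p.2, D (p.1, j) k = true :=
    h₁.forall_lt_comp (f := fun p : α × ℕ => f p.1) (hf.comp Primrec.fst)
  refine SigmaOne.of_eq (ex (of_primrecPred h₂)) fun a => ?_
  constructor
  · rintro ⟨K, hK⟩ j hj
    obtain ⟨k, -, hk⟩ := hK j hj
    exact (h _).2 ⟨k, hk⟩
  · intro H
    choose! g hg using fun j hj => (h _).1 (H j hj)
    refine ⟨(Finset.range (f a)).sup g + 1, fun j hj => ⟨g j, ?_, hg j hj⟩⟩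
    exact Nat.lt_succ_of_le (Finset.le_sup (f := g) (Finset.mem_range.2 hj))

theorem ball_mem {R : α × β → Prop} (hR : SigmaOne R) {l : α → List β} (hl : Primrec l) :
    SigmaOne fun a => ∀ b ∈ l a, R (a, b) := by
  have h₁ : SigmaOne fun p : (α × ℕ) × β => (l p.1.1)[p.1.2]? = some p.2 ∧ R (p.1.1, p.2) :=
    (of_primrecPred (Primrec.eq.comp (Primrec.list_getElem?.comp
      (hl.comp (Primrec.fst.comp Primrec.fst)) (Primrec.snd.comp Primrec.fst))
      (Primrec.option_some.comp Primrec.snd))).and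
    (hR.comp (Primrec.pair (Primrec.fst.comp Primrec.fst) Primrec.snd))
  refine (h₁.ex.ball_lt (f := fun a => (l a).length) (Primrec.list_length.comp hl)).of_eq
    fun a => ?_
  constructor
  · intro H b hb
    obtain ⟨i, hi, rfl⟩ := List.getElem_of_mem hb
    obtain ⟨b', hb', h⟩ := H i hi
    simp only [List.getElem?_eq_getElem hi, Option.some.injEq] at hb'
    rwa [hb']
  · intro H j hj
    exact ⟨(l a)[j], by simp [hj], H _ (List.getElem_mem hj)⟩

theorem graph {f : α →. β} (hf : Partrec f) : SigmaOne fun p : α × β => p.2 ∈ f p.1 := by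
  obtain ⟨c, hc⟩ := Nat.Partrec.Code.exists_code.1 hf
  have h : PrimrecPred fun p : (α × β) × ℕ =>
      Nat.Partrec.Code.evaln p.2 c (Encodable.encode p.1.1) = some (Encodable.encode p.1.2) :=
    Primrec.eq.comp (Nat.Partrec.Code.primrec_evaln.comp (Primrec.pair
        (Primrec.pair Primrec.snd (Primrec.const c))
        (Primrec.encode.comp (Primrec.fst.comp Primrec.fst))))
      (Primrec.option_some.comp (Primrec.encode.comp (Primrec.snd.comp Primrec.fst)))
  refine (ex (of_primrecPred h)).of_eq fun p => ?_
  have := Nat.Partrec.Code.evaln_complete (c := c) (n := Encodable.encode p.1)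
    (x := Encodable.encode p.2)
  simp only [Option.mem_def] at this
  rw [← this, hc]
  simp

end SigmaOne

section Complexity

variable {U : Str × Str →. Str}

theorem UniversalM.exists_program (hU : UniversalM U) (x y : Str) : ∃ q, x ∈ U (q, y) := by
  obtain ⟨c, hc⟩ := hU.2 (fun p => Part.some p.1) (Computable.fst.partrec)
  obtain ⟨q, hq, -⟩ := hc x y x (Part.mem_some _)
  exact ⟨q, hq⟩

theorem KC_le_iff (hU : UniversalM U) {x y : Str} {t : ℕ} :
    KC U x y ≤ t ↔ ∃ q : Str, q.length ≤ t ∧ x ∈ U (q, y) := by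
  constructor
  · intro h
    have hne : {l : ℕ | ∃ p : Str, p.length = l ∧ x ∈ U (p, y)}.Nonempty := by
      obtain ⟨q, hq⟩ := hU.exists_program x y
      exact ⟨_, q, rfl, hq⟩
    obtain ⟨q, hq, hx⟩ := Nat.sInf_mem hne
    exact ⟨q, hq.trans_le h, hx⟩
  · rintro ⟨q, hq, hx⟩
    have : KC U x y ≤ q.length := Nat.sInf_le ⟨q, rfl, hx⟩
    exact this.trans hq

theorem KC_le_of_partrec (hU : UniversalM U) {M : Str × Str →. Str} (hM : Partrec M) :
    ∃ c, ∀ x y p : Str, x ∈ M (p, y) → KC U x y ≤ p.length + c := by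
  obtain ⟨c, hc⟩ := hU.2 M hM
  refine ⟨c, fun x y p hx => ?_⟩
  obtain ⟨q, hq, hl⟩ := hc x y p hx
  exact (KC_le_iff hU).2 ⟨q, hl, hq⟩

theorem KC_le_length (hU : UniversalM U) : ∃ c, ∀ x y : Str, KC U x y ≤ x.length + c := by
  obtain ⟨c, hc⟩ := KC_le_of_partrec hU (M := fun p => Part.some p.1) (Computable.fst.partrec)
  exact ⟨c, fun x y => hc x y x (Part.mem_some _)⟩

theorem sigmaOne_KC_le (hU : UniversalM U) :
    SigmaOne fun a : ℕ × Str × Str => KC U a.2.1 a.2.2 ≤ a.1 := by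
  have h₁ : SigmaOne fun p : (ℕ × Str × Str) × Str => p.2.length ≤ p.1.1 :=
    .of_primrecPred (Primrec.nat_le.comp (Primrec.list_length.comp Primrec.snd)
      (Primrec.fst.comp Primrec.fst))
  have h₂ : SigmaOne fun p : (ℕ × Str × Str) × Str => p.1.2.1 ∈ U (p.2, p.1.2.2) :=
    (SigmaOne.graph hU.1).comp (f := fun p : (ℕ × Str × Str) × Str => ((p.2, p.1.2.2), p.1.2.1))
      (Primrec.pair (Primrec.pair Primrec.snd (Primrec.snd.comp (Primrec.snd.comp Primrec.fst)))
        (Primrec.fst.comp (Primrec.snd.comp Primrec.fst)))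
  exact (h₁.and h₂).ex.of_eq fun a =>
    (KC_le_iff hU (x := a.2.1) (y := a.2.2) (t := a.1)).symm

theorem strVal_concat_true_injective :
    Function.Injective fun q : Str => strVal (q ++ [true]) := by
  have key : ∀ q r : Str, strVal (q ++ [true]) = strVal (r ++ [true]) → r.length ≤ q.length := by
    intro q r h
    by_contra! hlt
    have := congrArg (fun v => v.testBit r.length) h
    simp only [testBit_strVal] at this
    simp [List.getD_eq_getElem?_getD, List.getElem?_append, not_lt.2 hlt.le] at this
    rw [List.getElem?_eq_none (by simp; omega)] at this
    simp at this
  intro q r h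
  have hl := le_antisymm (key r q h.symm) (key q r h)
  exact List.append_cancel_right (strVal_injOn_length (by simp [hl]) h)

theorem card_le_of_forall_KC_le (hU : UniversalM U) {y : Str} {t : ℕ} {F : Finset Str}
    (hF : ∀ x ∈ F, KC U x y ≤ t) : F.card ≤ 2 ^ (t + 1) := by
  choose! g hg using fun x hx => (KC_le_iff hU).1 (hF x hx)
  have := Finset.card_le_card_of_injOn (s := F) (t := Finset.range (2 ^ (t + 1)))
    (fun x => strVal (g x ++ [true]))
    (fun x hx => by
      have h₁ := strVal_lt (g x ++ [true])
      have h₂ : 2 ^ (g x ++ [true]).length ≤ 2 ^ (t + 1) :=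
        Nat.pow_le_pow_right two_pos (by simpa using (hg x hx).1)
      simpa using h₁.trans_le h₂)
    (fun x hx x' hx' h => by
      have hq := strVal_concat_true_injective h
      have h' := (hg x' hx').2
      rw [← hq] at h'
      exact Part.mem_unique (hg x hx).2 h')
  simpa using this

/-- Splits a string consisting of `a` ones, a zero and a string `w` into the number with digits
the first `a` bits of `w` and the number with digits the remaining bits of `w`. -/
def splitProgram (q : Str) : ℕ × ℕ :=
  let a := q.findIdx not
  let w := strVal (q.drop (a + 1))
  (w % 2 ^ a, w / 2 ^ a)

theorem primrec_splitProgram : Primrec splitProgram := by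
  have ha : Primrec fun q : Str => q.findIdx not :=
    Primrec.list_findIdx (p := fun _ b => !b) Primrec.id (Primrec.not.comp Primrec.snd)
  have hp := Primrec.nat_pow.comp (Primrec.const 2) ha
  have hw := primrec_strVal.comp (Primrec.list_drop.comp (Primrec.succ.comp ha) Primrec.id)
  exact Primrec.pair (Primrec.nat_mod.comp hw hp) (Primrec.nat_div.comp hw hp)

theorem exists_splitProgram_eq {p i a s : ℕ} (hp : p < 2 ^ a) (hi : i < 2 ^ s) :
    ∃ q : Str, splitProgram q = (p, i) ∧ q.length = s + 2 * a + 1 := by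
  refine ⟨List.replicate a true ++ false :: lowBits (a + s) (p + 2 ^ a * i), ?_, ?_⟩
  · have hf : (List.replicate a true ++ false :: lowBits (a + s) (p + 2 ^ a * i)).findIdx not
        = a := by
      rw [List.findIdx_append, List.findIdx_eq_length_of_false] <;> simp [List.findIdx_cons]
    have hlt : p + 2 ^ a * i < 2 ^ (a + s) := by
      rw [pow_add]
      calc p + 2 ^ a * i < 2 ^ a * (i + 1) := by rw [mul_add]; omega
        _ ≤ _ := Nat.mul_le_mul_left _ hi
    have hd : (List.replicate a true ++ false :: lowBits (a + s) (p + 2 ^ a * i)).drop (a + 1)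
        = lowBits (a + s) (p + 2 ^ a * i) := by
      rw [List.drop_append, List.drop_of_length_le (by simp)]
      simp
    simp only [splitProgram, hf, hd, strVal_lowBits, Nat.mod_eq_of_lt hlt]
    rw [Nat.add_mul_mod_self_left, Nat.mod_eq_of_lt hp,
      Nat.add_mul_div_left _ _ (by positivity), Nat.div_eq_of_lt hp, zero_add]
  · simp; omega

/-- In a recursively enumerable family of sets of strings, the elements of a set with at most
`2 ^ s` members have complexity at most `s`, up to the length of the parameter. -/
theorem KC_le_of_sigmaOne (hU : UniversalM U) {R : ℕ × Str × Str → Prop} (hR : SigmaOne R) :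
    ∃ c, ∀ p a s y u, p < 2 ^ a → R (p, y, u) →
      (∀ F : Finset Str, (∀ v ∈ F, R (p, y, v)) → F.card ≤ 2 ^ s) →
      KC U u y ≤ s + 2 * a + c := by
  classical
  obtain ⟨D, hD, hRD⟩ := hR
  let e : ℕ × Str → ℕ → Option Str := fun z N =>
    (Encodable.decode (α := Str) N.unpair.1).bind fun u =>
      bif D (z.1, z.2, u) N.unpair.2 then some u else none
  have he : Primrec₂ e := by
    refine Primrec.option_bind
      (Primrec.decode.comp (Primrec.fst.comp (Primrec.unpair.comp Primrec.snd))) ?_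
    refine Primrec.cond (hD.comp (Primrec.pair (Primrec.fst.comp (Primrec.fst.comp Primrec.fst))
      (Primrec.pair (Primrec.snd.comp (Primrec.fst.comp Primrec.fst)) Primrec.snd))
      (Primrec.snd.comp (Primrec.unpair.comp (Primrec.snd.comp Primrec.fst))))
      (Primrec.option_some.comp Primrec.snd) (Primrec.const none)
  have heR : ∀ z u, R (z.1, z.2, u) ↔ ∃ N, e z N = some u := by
    intro z u
    rw [hRD]
    constructor
    · rintro ⟨k, hk⟩
      exact ⟨Nat.pair (Encodable.encode u) k, by simp [e, hk]⟩
    · rintro ⟨N, hN⟩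
      simp only [e, Option.bind_eq_some_iff] at hN
      obtain ⟨v, -, hv⟩ := hN
      cases hDv : D (z.1, z.2, v) N.unpair.2
      · simp [hDv] at hv
      · simp only [hDv, cond_true, Option.some.injEq] at hv
        exact ⟨_, hv ▸ hDv⟩
  let fresh : (ℕ × Str) × ℕ → Prop := fun w =>
    e w.1 w.2 ≠ none ∧ ∀ N' < w.2, e w.1 N' ≠ e w.1 w.2
  have hfresh : PrimrecPred fresh := by
    refine PrimrecPred.and (PrimrecPred.not (Primrec.eq.comp
      (he.comp Primrec.fst Primrec.snd) (Primrec.const none))) ?_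
    exact PrimrecPred.forall_lt_comp
      (R := fun w : ((ℕ × Str) × ℕ) × ℕ => e w.1.1 w.2 ≠ e w.1.1 w.1.2)
      (PrimrecPred.not (Primrec.eq.comp (he.comp (Primrec.fst.comp Primrec.fst) Primrec.snd)
        (he.comp (Primrec.fst.comp Primrec.fst) (Primrec.snd.comp Primrec.fst)))) Primrec.snd
  let num : (ℕ × Str) × ℕ → ℕ := fun w => Nat.count (fun N => fresh (w.1, N)) w.2
  have hnum : Primrec num := by
    have h₁ : Primrec fun w : ((ℕ × Str) × ℕ) × ℕ => if fresh (w.1.1, w.2) then 1 else 0 :=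
      Primrec.ite (hfresh.comp (Primrec.pair (Primrec.fst.comp Primrec.fst) Primrec.snd))
        (Primrec.const 1) (Primrec.const 0)
    exact (Primrec.sum_range h₁ Primrec.snd).of_eq fun w => by
      simp [num, Nat.count_eq_card_filter_range, Finset.card_filter]
  let M : Str × Str →. Str := fun b => Nat.rfindOpt fun N =>
    if fresh (((splitProgram b.1).1, b.2), N) ∧
      num (((splitProgram b.1).1, b.2), N) = (splitProgram b.1).2
    then e ((splitProgram b.1).1, b.2) N else none
  have hM : Partrec M := by
    have hz : Primrec fun b : (Str × Str) × ℕ => (((splitProgram b.1.1).1, b.1.2), b.2) :=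
      Primrec.pair (Primrec.pair
        (Primrec.fst.comp (primrec_splitProgram.comp (Primrec.fst.comp Primrec.fst)))
        (Primrec.snd.comp Primrec.fst)) Primrec.snd
    refine Partrec.rfindOpt (Primrec.to_comp ?_)
    exact Primrec.ite (PrimrecPred.and (hfresh.comp hz) (Primrec.eq.comp (hnum.comp hz)
      (Primrec.snd.comp (primrec_splitProgram.comp (Primrec.fst.comp Primrec.fst)))))
      (he.comp (Primrec.fst.comp hz) Primrec.snd) (Primrec.const none)
  obtain ⟨c, hc⟩ := KC_le_of_partrec hU hM
  refine ⟨c + 1, fun p a s y u hp hu hcard => ?_⟩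
  have hex := (heR (p, y) u).1 hu
  set N := Nat.find hex with hNdef
  have hN : e (p, y) N = some u := Nat.find_spec hex
  have hNmin : ∀ N' < N, e (p, y) N' ≠ some u := fun N' h => Nat.find_min hex h
  have hNf : fresh ((p, y), N) := ⟨by simp [hN], fun N' h => by simpa [hN] using hNmin N' h⟩
  have hidx : num ((p, y), N) < 2 ^ s := by
    let S := (Finset.range N).filter fun N' => fresh ((p, y), N')
    have hS : ∀ N' ∈ S, ∃ v, e (p, y) N' = some v := fun N' h => by
      have := (Finset.mem_filter.1 h).2.1
      exact Option.ne_none_iff_exists'.1 this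
    choose! g hg using hS
    have hinj : Set.InjOn g S := by
      have key : ∀ i ∈ S, ∀ j ∈ S, g i = g j → ¬ i < j := by
        intro i hi j hj h hlt
        exact (Finset.mem_filter.1 hj).2.2 i hlt (by simp [hg i hi, hg j hj, h])
      intro i hi j hj h
      exact le_antisymm (not_lt.1 (key j hj i hi h.symm)) (not_lt.1 (key i hi j hj h))
    have hnot : u ∉ S.image g := by
      intro h
      obtain ⟨i, hi, rfl⟩ := Finset.mem_image.1 h
      exact hNmin i (Finset.mem_range.1 (Finset.mem_filter.1 hi).1) (hg i hi)
    have := hcard (insert u (S.image g)) fun v hv => by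
      rcases Finset.mem_insert.1 hv with rfl | hv
      · exact hu
      · obtain ⟨i, hi, rfl⟩ := Finset.mem_image.1 hv
        exact (heR (p, y) _).2 ⟨i, hg i hi⟩
    rw [Finset.card_insert_of_notMem hnot, Finset.card_image_of_injOn hinj] at this
    simpa [num, Nat.count_eq_card_filter_range, S] using this
  obtain ⟨q, hq, hql⟩ := exists_splitProgram_eq hp hidx
  have hmem : u ∈ M (q, y) := by
    have hdom : (M (q, y)).Dom := Nat.rfindOpt_dom.2 ⟨N, u, by simp [hq, hNf, hN]⟩
    obtain ⟨v, hv⟩ := Part.dom_iff_mem.1 hdom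
    obtain ⟨N', hN'⟩ := Nat.rfindOpt_spec hv
    simp only [hq] at hN'
    split_ifs at hN' with hcond
    · have : N' = N := Nat.count_injective (p := fun N => fresh ((p, y), N)) hcond.1 hNf hcond.2
      rw [this, hN] at hN'
      simp only [Option.mem_def, Option.some.injEq] at hN'
      rwa [hN']
    · simp at hN'
  have := hc u y q hmem
  omega

end Complexity

section Symmetry

variable {U : Str × Str →. Str}

theorem Nat.pair_lt_two_pow {a b f : ℕ} (ha : a < 2 ^ f) (hb : b < 2 ^ f) :
    Nat.pair a b < 2 ^ (2 * f) := by
  refine (Nat.pair_lt_max_add_one_sq a b).trans_le ?_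
  rw [mul_comm, pow_mul]
  exact Nat.pow_le_pow_left (max_lt ha hb) 2

/-- Iterated unpairing of a number into five components. -/
def unpairFive (p : ℕ) : ℕ × ℕ × ℕ × ℕ × ℕ :=
  (p.unpair.1, p.unpair.2.unpair.1, p.unpair.2.unpair.2.unpair.1,
    p.unpair.2.unpair.2.unpair.2.unpair.1, p.unpair.2.unpair.2.unpair.2.unpair.2)

theorem primrec_unpairFive : Primrec unpairFive := by
  have h₁ : Primrec fun p : ℕ => p.unpair.1 := Primrec.fst.comp Primrec.unpair
  have h₂ : Primrec fun p : ℕ => p.unpair.2 := Primrec.snd.comp Primrec.unpair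
  exact h₁.pair <| (h₁.comp h₂).pair <| (h₁.comp (h₂.comp h₂)).pair <|
    (h₁.comp (h₂.comp (h₂.comp h₂))).pair (h₂.comp (h₂.comp (h₂.comp h₂)))

theorem KC_le_of_sigmaOne_five (hU : UniversalM U)
    {R : (ℕ × ℕ × ℕ × ℕ × ℕ) × Str × Str → Prop} (hR : SigmaOne R) :
    ∃ c, ∀ p₁ p₂ p₃ p₄ p₅ f s y u, p₁ < 2 ^ f → p₂ < 2 ^ f → p₃ < 2 ^ f → p₄ < 2 ^ f →
      p₅ < 2 ^ f → R ((p₁, p₂, p₃, p₄, p₅), y, u) →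
      (∀ F : Finset Str, (∀ v ∈ F, R ((p₁, p₂, p₃, p₄, p₅), y, v)) → F.card ≤ 2 ^ s) →
      KC U u y ≤ s + 32 * f + c := by
  obtain ⟨c, hc⟩ := KC_le_of_sigmaOne hU (R := fun a => R (unpairFive a.1, a.2))
    (hR.comp ((primrec_unpairFive.comp Primrec.fst).pair Primrec.snd))
  refine ⟨c, fun p₁ p₂ p₃ p₄ p₅ f s y u h₁ h₂ h₃ h₄ h₅ hu hcard => ?_⟩
  have hmono : ∀ {x k : ℕ}, x < 2 ^ f → 1 ≤ k → x < 2 ^ (k * f) := fun hx hk =>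
    hx.trans_le (Nat.pow_le_pow_right two_pos (Nat.le_mul_of_pos_left f hk))
  have h₄₅ := Nat.pair_lt_two_pow h₄ h₅
  have h₃₅ := Nat.pair_lt_two_pow (hmono h₃ (by norm_num)) h₄₅
  rw [← mul_assoc] at h₃₅
  have h₂₅ := Nat.pair_lt_two_pow (hmono h₂ (by norm_num)) h₃₅
  rw [← mul_assoc] at h₂₅
  have h₁₅ := Nat.pair_lt_two_pow (hmono h₁ (by norm_num)) h₂₅
  have := hc _ _ s y u h₁₅ (by simpa [unpairFive] using hu) (by simpa [unpairFive] using hcard)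
  omega

/-- `g` is a string of length `n'` and complexity at most `t` whose length-`n` prefix is `u`. -/
def IsExtension (U : Str × Str →. Str) (n n' t : ℕ) (u g : Str) : Prop :=
  g.length = n' ∧ lowBits n (strVal g) = u ∧ KC U g [] ≤ t

theorem sigmaOne_isExtension (hU : UniversalM U) :
    SigmaOne fun a : (ℕ × ℕ × ℕ) × Str × Str =>
      IsExtension U a.1.1 a.1.2.1 a.1.2.2 a.2.1 a.2.2 := by
  have hg : Primrec fun a : (ℕ × ℕ × ℕ) × Str × Str => a.2.2 := Primrec.snd.comp Primrec.snd
  refine (SigmaOne.of_primrecPred ?_).and ((SigmaOne.of_primrecPred ?_).and ?_)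
  · exact Primrec.eq.comp (Primrec.list_length.comp hg)
      (Primrec.fst.comp (Primrec.snd.comp Primrec.fst))
  · exact Primrec.eq.comp (primrec_lowBits.comp (Primrec.fst.comp Primrec.fst)
      (primrec_strVal.comp hg)) (Primrec.fst.comp Primrec.snd)
  · exact (sigmaOne_KC_le hU).comp
      ((Primrec.snd.comp (Primrec.snd.comp Primrec.fst)).pair (hg.pair (Primrec.const [])))

theorem primrecPred_nodup : PrimrecPred fun l : List Str => l.Nodup := by
  have h₁ : PrimrecPred fun a : (List Str × ℕ) × ℕ => a.1.1[a.2]? ≠ a.1.1[a.1.2]? :=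
    PrimrecPred.not (Primrec.eq.comp
      (Primrec.list_getElem?.comp (Primrec.fst.comp Primrec.fst) Primrec.snd)
      (Primrec.list_getElem?.comp (Primrec.fst.comp Primrec.fst)
        (Primrec.snd.comp Primrec.fst)))
  have h₂ : PrimrecPred fun a : List Str × ℕ => ∀ i < a.2, a.1[i]? ≠ a.1[a.2]? :=
    h₁.forall_lt_comp Primrec.snd
  refine (h₂.forall_lt_comp Primrec.list_length).of_eq fun l => ?_
  rw [List.nodup_iff_getElem?_ne_getElem?]
  exact ⟨fun h i j hij hj => h j hj i hij, fun h j hj i hij => h i j hij hj⟩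

theorem lowBits_lowBits {n n' : ℕ} (h : n ≤ n') (v : ℕ) :
    lowBits n (strVal (lowBits n' v)) = lowBits n v := by
  rw [strVal_lowBits, lowBits_mod h]

theorem exists_KC_prefix_add_KC_le (hU : UniversalM U) :
    ∃ c, ∀ n n' v e, n ≤ n' → n' < 2 ^ e →
      KC U (lowBits n v) [] + KC U (lowBits n' v) (lowBits n v) ≤
        KC U (lowBits n' v) [] + 64 * e + c := by
  classical
  obtain ⟨c₀, hc₀⟩ := KC_le_length hU
  have hE := sigmaOne_isExtension hU
  obtain ⟨c₁, hc₁⟩ := KC_le_of_sigmaOne_five hU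
    (R := fun a => IsExtension U a.1.1 a.1.2.1 a.1.2.2.1 a.2.1 a.2.2)
    (hE.comp (f := fun a : (ℕ × ℕ × ℕ × ℕ × ℕ) × Str × Str =>
      ((a.1.1, a.1.2.1, a.1.2.2.1), a.2))
      (Primrec.pair ((Primrec.fst.comp Primrec.fst).pair
        ((Primrec.fst.comp (Primrec.snd.comp Primrec.fst)).pair
          (Primrec.fst.comp (Primrec.snd.comp (Primrec.snd.comp Primrec.fst))))) Primrec.snd))
  have hR₂ : SigmaOne fun a : (ℕ × ℕ × ℕ × ℕ × ℕ) × Str × Str => ∃ L : List Str,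
      L.Nodup ∧ 2 ^ a.1.2.2.2.1 ≤ L.length ∧
        ∀ g ∈ L, IsExtension U a.1.1 a.1.2.1 a.1.2.2.1 a.2.2 g := by
    refine SigmaOne.ex (R := fun b : ((ℕ × ℕ × ℕ × ℕ × ℕ) × Str × Str) × List Str =>
      b.2.Nodup ∧ 2 ^ b.1.1.2.2.2.1 ≤ b.2.length ∧
        ∀ g ∈ b.2, IsExtension U b.1.1.1 b.1.1.2.1 b.1.1.2.2.1 b.1.2.2 g) ?_
    have hp : Primrec fun b : ((ℕ × ℕ × ℕ × ℕ × ℕ) × Str × Str) × List Str => b.1.1 :=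
      Primrec.fst.comp Primrec.fst
    refine (SigmaOne.of_primrecPred (primrecPred_nodup.comp Primrec.snd)).and
      ((SigmaOne.of_primrecPred ?_).and ?_)
    · exact Primrec.nat_le.comp (Primrec.nat_pow.comp (Primrec.const 2)
        (Primrec.fst.comp (Primrec.snd.comp (Primrec.snd.comp (Primrec.snd.comp hp)))))
        (Primrec.list_length.comp Primrec.snd)
    · refine SigmaOne.ball_mem (R := fun d :
        (((ℕ × ℕ × ℕ × ℕ × ℕ) × Str × Str) × List Str) × Str =>
        IsExtension U d.1.1.1.1 d.1.1.1.2.1 d.1.1.1.2.2.1 d.1.1.2.2 d.2) ?_ Primrec.snd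
      have hp' : Primrec fun d : (((ℕ × ℕ × ℕ × ℕ × ℕ) × Str × Str) × List Str) × Str =>
        d.1.1.1 := hp.comp Primrec.fst
      exact hE.comp (f := fun d : (((ℕ × ℕ × ℕ × ℕ × ℕ) × Str × Str) × List Str) × Str =>
        ((d.1.1.1.1, d.1.1.1.2.1, d.1.1.1.2.2.1), (d.1.1.2.2, d.2)))
        (Primrec.pair ((Primrec.fst.comp hp').pair ((Primrec.fst.comp (Primrec.snd.comp hp')).pair
          (Primrec.fst.comp (Primrec.snd.comp (Primrec.snd.comp hp')))))
          ((Primrec.snd.comp (Primrec.snd.comp (Primrec.fst.comp Primrec.fst))).pair Primrec.snd))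
  obtain ⟨c₂, hc₂⟩ := KC_le_of_sigmaOne_five hU hR₂
  refine ⟨64 * (c₀ + 2) + c₁ + c₂ + 2, fun n n' v e hn hn' => ?_⟩
  set u := lowBits n v
  set t := KC U (lowBits n' v) [] with ht
  have htn : t ≤ n' + c₀ := by simpa using hc₀ (lowBits n' v) []
  let G : Finset Str := ((Finset.range (2 ^ n')).image (lowBits n')).filter
    fun g => IsExtension U n n' t u g
  have hG : ∀ g, g ∈ G ↔ IsExtension U n n' t u g := by
    intro g
    refine ⟨fun h => (Finset.mem_filter.1 h).2, fun h => Finset.mem_filter.2 ⟨?_, h⟩⟩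
    refine Finset.mem_image.2 ⟨strVal g, ?_, ?_⟩
    · rw [Finset.mem_range, ← h.1]; exact strVal_lt g
    · rw [← h.1]; exact lowBits_strVal g
  have hself : IsExtension U n n' t u (lowBits n' v) :=
    ⟨by simp, lowBits_lowBits hn v, le_rfl⟩
  have hGne : G.card ≠ 0 := Finset.card_ne_zero.2 ⟨_, (hG _).2 hself⟩
  set s := Nat.log 2 G.card
  have hs₁ : 2 ^ s ≤ G.card := Nat.pow_log_le_self 2 hGne
  have hs₂ : G.card < 2 ^ (s + 1) := Nat.lt_pow_succ_log_self one_lt_two _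
  have hGt : G.card ≤ 2 ^ (t + 1) := card_le_of_forall_KC_le hU fun g hg => ((hG g).1 hg).2.2
  have hst : s ≤ t + 1 := (Nat.pow_le_pow_iff_right one_lt_two).1 (hs₁.trans hGt)
  have hf : n' + c₀ + 1 < 2 ^ (e + (c₀ + 2)) := by
    have h₁ : c₀ + 2 < 2 ^ (c₀ + 2) := Nat.lt_two_pow_self
    have h₂ : 1 ≤ 2 ^ e := Nat.one_le_two_pow
    rw [pow_add]
    nlinarith
  have hn'f : n' < 2 ^ (e + (c₀ + 2)) := by omega
  have k₁ := hc₁ n n' t 0 0 (e + (c₀ + 2)) (s + 1) u (lowBits n' v) (by omega) hn'f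
    (by omega) (by positivity) (by positivity) hself
    (fun F hF => (Finset.card_le_card fun g hg => (hG g).2 (hF g hg)).trans hs₂.le)
  have k₂ := hc₂ n n' t s 0 (e + (c₀ + 2)) (t + 1 - s) [] u (by omega) hn'f
    (by omega) (by omega) (by positivity)
    ⟨G.toList, G.nodup_toList, by simpa using hs₁, fun g hg => (hG g).1 (by simpa using hg)⟩
    (fun F hF => by
      choose! L hL₁ hL₂ hL₃ using hF
      have hdisj : (F : Set Str).PairwiseDisjoint fun w => (L w).toFinset := by
        intro w hw w' hw' hne
        refine Finset.disjoint_left.2 fun g hg hg' => hne ?_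
        rw [List.mem_toFinset] at hg hg'
        exact (hL₃ w hw g hg).2.1.symm.trans (hL₃ w' hw' g hg').2.1
      have h₁ : F.card * 2 ^ s ≤ (F.biUnion fun w => (L w).toFinset).card := by
        rw [Finset.card_biUnion hdisj, ← smul_eq_mul]
        refine Finset.card_nsmul_le_sum _ _ _ fun w hw => ?_
        rw [List.toFinset_card_of_nodup (hL₁ w hw)]
        exact hL₂ w hw
      have h₂ : (F.biUnion fun w => (L w).toFinset).card ≤ 2 ^ (t + 1) :=
        card_le_of_forall_KC_le hU (y := []) fun g hg => by
          obtain ⟨w, hw, hg⟩ := Finset.mem_biUnion.1 hg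
          exact (hL₃ w hw g (List.mem_toFinset.1 hg)).2.2
      have h₃ : 2 ^ (t + 1) = 2 ^ (t + 1 - s) * 2 ^ s := by rw [← pow_add]; congr 1; omega
      exact Nat.le_of_mul_le_mul_right (h₃ ▸ h₁.trans h₂) (by positivity))
  omega

theorem exists_KC_le_KC_prefix (hU : UniversalM U) :
    ∃ c, ∀ n t v g f, n ≤ f → t < 2 ^ f → KC U g (lowBits n v) ≤ t →
      KC U g [] ≤ t + 32 * f + c := by
  obtain ⟨c, hc⟩ := KC_le_of_sigmaOne_five hU
    (R := fun a => KC U a.2.2 (lowBits a.1.1 a.1.2.1) ≤ a.1.2.2.1)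
    ((sigmaOne_KC_le hU).comp (f := fun a : (ℕ × ℕ × ℕ × ℕ × ℕ) × Str × Str =>
      (a.1.2.2.1, a.2.2, lowBits a.1.1 a.1.2.1))
      (Primrec.pair (Primrec.fst.comp (Primrec.snd.comp (Primrec.snd.comp Primrec.fst)))
        ((Primrec.snd.comp Primrec.snd).pair (primrec_lowBits.comp (Primrec.fst.comp Primrec.fst)
          (Primrec.fst.comp (Primrec.snd.comp Primrec.fst))))))
  refine ⟨c + 1, fun n t v g f hn ht h => ?_⟩
  have h₁ : n < 2 ^ f := hn.trans_lt Nat.lt_two_pow_self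
  have h₂ : v % 2 ^ n < 2 ^ f := (Nat.mod_lt _ (by positivity)).trans_le
    (Nat.pow_le_pow_right two_pos hn)
  have := hc n (v % 2 ^ n) t 0 0 f (t + 1) [] g h₁ h₂ ht (by positivity) (by positivity)
    (by simpa [lowBits_mod] using h)
    (fun F hF => card_le_of_forall_KC_le hU (y := lowBits n v) fun w hw => by
      simpa [lowBits_mod] using hF w hw)
  omega

end Symmetry

section Tables

open Finset

/-- The `j`-th digit of `P` in base `W`. -/
def digit (W P j : ℕ) : ℕ := P / W ^ j % W

theorem primrec_digit : Primrec fun a : ℕ × ℕ × ℕ => digit a.1 a.2.1 a.2.2 :=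
  Primrec.nat_mod.comp (Primrec.nat_div.comp (Primrec.fst.comp Primrec.snd)
    (Primrec.nat_pow.comp Primrec.fst (Primrec.snd.comp Primrec.snd))) Primrec.fst

theorem exists_digit_eq {W : ℕ} (L : ℕ) (f : ℕ → ℕ) (hf : ∀ j < L, f j < W) :
    ∃ P < W ^ L, ∀ j < L, digit W P j = f j := by
  induction L with
  | zero => exact ⟨0, by simp, by simp⟩
  | succ L ih =>
    obtain ⟨P, hP, h⟩ := ih fun j hj => hf j (by omega)
    have hL := hf L (by omega)
    have hW : 0 < W := by omega
    refine ⟨P + W ^ L * f L, ?_, fun j hj => ?_⟩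
    · calc P + W ^ L * f L < W ^ L + W ^ L * f L := by omega
        _ = W ^ L * (f L + 1) := by ring
        _ ≤ W ^ L * W := Nat.mul_le_mul_left _ hL
        _ = W ^ (L + 1) := (pow_succ _ _).symm
    · rcases (Nat.lt_succ_iff_lt_or_eq.1 hj) with hj | rfl
      · obtain ⟨d, rfl⟩ : ∃ d, L = j + (d + 1) := ⟨L - j - 1, by omega⟩
        rw [← h j hj, digit, digit, show P + W ^ (j + (d + 1)) * f (j + (d + 1)) =
          P + W ^ j * (W * (W ^ d * f (j + (d + 1)))) by ring,
          Nat.add_mul_div_left _ _ (by positivity), Nat.add_mul_mod_self_left]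
      · rw [digit, Nat.add_mul_div_left _ _ (by positivity), Nat.div_eq_of_lt hP, zero_add,
          Nat.mod_eq_of_lt hL]

theorem sum_two_pow_card_eq {ι : Type*} [Fintype ι] [DecidableEq ι] {M : ℕ} (S : Finset ι)
    (c : Fin M) :
    ∑ T : ι → Fin M, 2 ^ #{p ∈ S | T p = c} = (M + 1) ^ #S * M ^ (Fintype.card ι - #S) := by
  have h := Finset.prod_univ_sum (fun _ : ι => (univ : Finset (Fin M)))
    (fun p d => if p ∈ S ∧ d = c then 2 else 1)
  have h₁ : ∀ p, ∑ d : Fin M, (if p ∈ S ∧ d = c then 2 else 1) =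
      if p ∈ S then M + 1 else M := by
    intro p
    by_cases hp : p ∈ S
    · simp only [hp, true_and, if_true]
      have : ∀ d : Fin M, (if d = c then 2 else 1) = 1 + if d = c then 1 else 0 := by
        intro d; split_ifs <;> rfl
      simp [this, sum_add_distrib]
    · simp [hp]
  simp_rw [h₁, Fintype.piFinset_univ] at h
  rw [prod_ite, prod_const, prod_const, filter_mem_eq_inter, univ_inter] at h
  rw [show #{x | x ∉ S} = Fintype.card ι - #S by
    rw [← card_compl]; congr 1; ext; simp] at h
  rw [h]
  refine sum_congr rfl fun T _ => ?_
  rw [prod_ite, prod_const, prod_const_one, mul_one]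
  congr 2
  ext; simp

theorem add_one_pow_le_four_mul_pow {M : ℕ} (hM : 0 < M) : (M + 1) ^ M ≤ 4 * M ^ M := by
  have hM' : (0 : ℝ) < M := by exact_mod_cast hM
  have h : ((M : ℝ) + 1) ^ M ≤ 4 * (M : ℝ) ^ M := by
    have h₁ : (1 + 1 / (M : ℝ)) ^ M ≤ Real.exp 1 := by
      calc (1 + 1 / (M : ℝ)) ^ M ≤ Real.exp (1 / M) ^ M := by
            gcongr; rw [add_comm]; exact Real.add_one_le_exp _
        _ = Real.exp 1 := by rw [← Real.exp_nat_mul]; congr 1; field_simp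
    have h₂ : Real.exp 1 ≤ 4 := by linarith [Real.exp_one_lt_d9]
    calc ((M : ℝ) + 1) ^ M = (1 + 1 / (M : ℝ)) ^ M * (M : ℝ) ^ M := by
          rw [← mul_pow]
          congr 1
          field_simp
      _ ≤ 4 * (M : ℝ) ^ M := by gcongr; exact h₁.trans h₂
  exact_mod_cast h

theorem exists_balanced_coloring {N K M q : ℕ} (hM : 0 < M) (hq : K * K = M * q)
    (h : N ^ (2 * K) * M * 4 ^ q < 2 ^ (8 * q)) :
    ∃ T : Fin N × Fin N → Fin M, ∀ A B : Finset (Fin N), #A = K → #B = K → ∀ c,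
      #{p ∈ A ×ˢ B | T p = c} ≤ 8 * q := by
  by_contra! H
  choose A B hA hB c hc using H
  let I : Finset ((Finset (Fin N) × Finset (Fin N)) × Fin M) :=
    (powersetCard K univ ×ˢ powersetCard K univ) ×ˢ univ
  have hI : #I ≤ N ^ (2 * K) * M := by
    have := Nat.choose_le_pow N K
    simp only [I, card_product, card_powersetCard, card_univ, Fintype.card_fin, two_mul, pow_add]
    gcongr
  let Ω := Fintype.card (Fin N × Fin N)
  have hlow : M ^ Ω * 2 ^ (8 * q) ≤
      ∑ T : Fin N × Fin N → Fin M, ∑ i ∈ I, 2 ^ #{p ∈ i.1.1 ×ˢ i.1.2 | T p = i.2} := by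
    have : M ^ Ω = #(univ : Finset (Fin N × Fin N → Fin M)) := by
      rw [card_univ, Fintype.card_fun, Fintype.card_fin]
    rw [this, ← smul_eq_mul]
    refine card_nsmul_le_sum _ _ _ fun T _ => ?_
    have hmem : ((A T, B T), c T) ∈ I := by simp [I, hA, hB]
    refine le_trans ?_ (single_le_sum (f := fun i : (Finset (Fin N) × Finset (Fin N)) × Fin M =>
      2 ^ #{p ∈ i.1.1 ×ˢ i.1.2 | T p = i.2}) (fun _ _ => Nat.zero_le _) hmem)
    exact Nat.pow_le_pow_right two_pos (hc T).le
  have hup : ∀ i ∈ I, ∑ T : Fin N × Fin N → Fin M, 2 ^ #{p ∈ i.1.1 ×ˢ i.1.2 | T p = i.2} ≤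
      4 ^ q * M ^ Ω := by
    rintro ⟨⟨A, B⟩, c⟩ hi
    simp only [I, mem_product, mem_powersetCard, mem_univ, and_true] at hi
    have hcard : #(A ×ˢ B) = M * q := by rw [card_product, hi.1.2, hi.2.2, hq]
    have hle : M * q ≤ Ω := hcard ▸ card_le_univ _
    rw [sum_two_pow_card_eq, hcard, pow_mul]
    calc ((M + 1) ^ M) ^ q * M ^ (Ω - M * q) ≤ (4 * M ^ M) ^ q * M ^ (Ω - M * q) := by
          gcongr; exact add_one_pow_le_four_mul_pow hM
      _ = 4 ^ q * M ^ Ω := by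
          rw [mul_pow, ← pow_mul, mul_assoc, ← pow_add, Nat.add_sub_cancel' hle]
  rw [sum_comm] at hlow
  have := hlow.trans (sum_le_card_nsmul _ _ _ hup)
  rw [smul_eq_mul, ← mul_assoc, mul_comm (M ^ Ω)] at this
  have h₂ := Nat.le_of_mul_le_mul_right this (by positivity)
  have h₃ : #I * 4 ^ q ≤ N ^ (2 * K) * M * 4 ^ q := Nat.mul_le_mul_right _ hI
  omega

/-- The table coded by `t` colors no `K × K` rectangle of `N × N` with any of the `M` colors
more than `8 * q` times. -/
def IsBalanced (N K M q t : ℕ) : Prop :=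
  ∀ A ⊆ range N, ∀ B ⊆ range N, #A = K → #B = K → ∀ c < M,
    #{p ∈ A ×ˢ B | digit M t (p.1 * N + p.2) = c} ≤ 8 * q

theorem exists_isBalanced {N K M q : ℕ} (hM : 0 < M) (hq : K * K = M * q)
    (h : N ^ (2 * K) * M * 4 ^ q < 2 ^ (8 * q)) :
    ∃ t < M ^ (N * N), IsBalanced N K M q t := by
  obtain ⟨T, hT⟩ := exists_balanced_coloring hM hq h
  obtain ⟨t, ht, hd⟩ := exists_digit_eq (W := M) (N * N)
    (fun j => if h : j / N < N ∧ j % N < N then T (⟨j / N, h.1⟩, ⟨j % N, h.2⟩) else 0)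
    (fun j _ => by split_ifs <;> simp [hM])
  refine ⟨t, ht, fun A hA B hB hAK hBK c hc => ?_⟩
  have hA' : ∀ a ∈ A, a < N := fun a ha => mem_range.1 (hA ha)
  have hB' : ∀ b ∈ B, b < N := fun b hb => mem_range.1 (hB hb)
  refine le_trans (le_of_eq ?_) (hT (A.attachFin hA') (B.attachFin hB')
    (by simpa) (by simpa) ⟨c, hc⟩)
  symm
  refine card_bij (fun p _ => (p.1.1, p.2.1)) ?_ ?_ ?_
  · rintro ⟨⟨a, ha⟩, ⟨b, hb⟩⟩ hp
    simp only [mem_filter, mem_product, mem_attachFin] at hp ⊢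
    refine ⟨hp.1, ?_⟩
    have hlt : a * N + b < N * N := by nlinarith
    have hdiv : (a * N + b) / N = a := by
      rw [mul_comm, Nat.mul_add_div (by omega), Nat.div_eq_of_lt hb, add_zero]
    have hmod : (a * N + b) % N = b := by
      rw [mul_comm, Nat.mul_add_mod, Nat.mod_eq_of_lt hb]
    rw [hd _ hlt]
    simp only [hdiv, hmod, ha, hb, and_self, dif_pos]
    simpa using congrArg Fin.val hp.2
  · rintro ⟨⟨a, ha⟩, ⟨b, hb⟩⟩ _ ⟨⟨a', ha'⟩, ⟨b', hb'⟩⟩ _ h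
    simpa using h
  · rintro ⟨a, b⟩ hp
    simp only [mem_filter, mem_product] at hp
    have ha := hA' a hp.1.1
    have hb := hB' b hp.1.2
    refine ⟨(⟨a, ha⟩, ⟨b, hb⟩), ?_, rfl⟩
    simp only [mem_filter, mem_product, mem_attachFin]
    refine ⟨hp.1, Fin.ext ?_⟩
    have hlt : a * N + b < N * N := by nlinarith
    have hdiv : (a * N + b) / N = a := by
      rw [mul_comm, Nat.mul_add_div (by omega), Nat.div_eq_of_lt hb, add_zero]
    have hmod : (a * N + b) % N = b := by
      rw [mul_comm, Nat.mul_add_mod, Nat.mod_eq_of_lt hb]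
    have := hd _ hlt
    simp only [hdiv, hmod, ha, hb, and_self, dif_pos] at this
    exact this.symm.trans hp.2

end Tables

section BalancedTable

open Finset

/-- The set of positions below `N` of the one bits of `A`. -/
def bitSet (N A : ℕ) : Finset ℕ := {i ∈ range N | A.testBit i = true}

theorem exists_bitSet_eq {N : ℕ} {S : Finset ℕ} (hS : S ⊆ range N) :
    ∃ A < 2 ^ N, bitSet N A = S := by
  have hl : ((List.range N).map fun i => decide (i ∈ S)).length = N := by simp
  refine ⟨strVal ((List.range N).map fun i => decide (i ∈ S)), ?_, ?_⟩
  · simpa only [hl] using strVal_lt ((List.range N).map fun i => decide (i ∈ S))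
  · ext i
    simp only [bitSet, mem_filter, mem_range, testBit_strVal]
    constructor
    · rintro ⟨hi, h⟩
      simpa [List.getD_eq_getElem?_getD, hi] using h
    · intro h
      have hi := mem_range.1 (hS h)
      exact ⟨hi, by simpa [List.getD_eq_getElem?_getD, hi] using h⟩

/-- The number of one bits of `A` at positions below `N`. -/
def bitCount (N A : ℕ) : ℕ := ∑ i ∈ range N, (A.testBit i).toNat

theorem card_bitSet (N A : ℕ) : #(bitSet N A) = bitCount N A := by
  rw [bitSet, card_filter]
  exact sum_congr rfl fun i _ => by cases A.testBit i <;> rfl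

/-- The number of occurrences of the color `c` in the rectangle `bitSet N A ×ˢ bitSet N B`. -/
def colorCount (N M t A B c : ℕ) : ℕ :=
  ∑ a ∈ range N, ∑ b ∈ range N, (A.testBit a).toNat * ((B.testBit b).toNat *
    if digit M t (a * N + b) = c then 1 else 0)

theorem card_filter_digit_eq (N M t A B c : ℕ) :
    #{p ∈ bitSet N A ×ˢ bitSet N B | digit M t (p.1 * N + p.2) = c} =
      colorCount N M t A B c := by
  rw [colorCount, card_filter, sum_product, bitSet, sum_filter]
  refine sum_congr rfl fun a _ => ?_
  rw [bitSet, sum_filter]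
  cases A.testBit a
  · simp
  · simp only [if_true, Bool.toNat_true, one_mul]
    refine sum_congr rfl fun b _ => ?_
    cases B.testBit b <;> simp

theorem isBalanced_iff {N K M q t : ℕ} : IsBalanced N K M q t ↔
    ∀ A < 2 ^ N, ∀ B < 2 ^ N, ∀ c < M, (¬ bitCount N A = K) ∨ (¬ bitCount N B = K) ∨
      colorCount N M t A B c ≤ 8 * q := by
  simp_rw [← card_bitSet, ← card_filter_digit_eq]
  constructor
  · intro h A _ B _ c hc
    have := h (bitSet N A) (filter_subset _ _) (bitSet N B) (filter_subset _ _)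
    tauto
  · intro h A hA B hB hAK hBK c hc
    obtain ⟨A, hA', rfl⟩ := exists_bitSet_eq hA
    obtain ⟨B, hB', rfl⟩ := exists_bitSet_eq hB
    have := h A hA' B hB' c hc
    tauto

section Primrec

variable {α : Type*} [Primcodable α] {N K M q t A B c i : α → ℕ}

theorem primrec_toNat_testBit (hA : Primrec A) (hi : Primrec i) :
    Primrec fun x => ((A x).testBit (i x)).toNat :=
  (Primrec.dom_finite Bool.toNat).comp (Primrec.nat_testBit.comp hA hi)

theorem primrec_bitCount (hN : Primrec N) (hA : Primrec A) :
    Primrec fun x => bitCount (N x) (A x) :=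
  Primrec.sum_range (g := fun p : α × ℕ => ((A p.1).testBit p.2).toNat)
    (primrec_toNat_testBit (hA.comp Primrec.fst) Primrec.snd) hN

theorem primrec_colorCount (hN : Primrec N) (hM : Primrec M) (ht : Primrec t) (hA : Primrec A)
    (hB : Primrec B) (hc : Primrec c) :
    Primrec fun x => colorCount (N x) (M x) (t x) (A x) (B x) (c x) := by
  have h : Primrec fun p : (α × ℕ) × ℕ => ((A p.1.1).testBit p.1.2).toNat *
      (((B p.1.1).testBit p.2).toNat *
        if digit (M p.1.1) (t p.1.1) (p.1.2 * N p.1.1 + p.2) = c p.1.1 then 1 else 0) := by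
    have hx : Primrec fun p : (α × ℕ) × ℕ => p.1.1 := Primrec.fst.comp Primrec.fst
    have ha : Primrec fun p : (α × ℕ) × ℕ => p.1.2 := Primrec.snd.comp Primrec.fst
    exact Primrec.nat_mul.comp (primrec_toNat_testBit (hA.comp hx) ha)
      (Primrec.nat_mul.comp (primrec_toNat_testBit (hB.comp hx) Primrec.snd)
        (Primrec.ite (Primrec.eq.comp (primrec_digit.comp (Primrec.pair (hM.comp hx)
          (Primrec.pair (ht.comp hx) (Primrec.nat_add.comp
            (Primrec.nat_mul.comp ha (hN.comp hx)) Primrec.snd)))) (hc.comp hx))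
          (Primrec.const 1) (Primrec.const 0)))
  exact Primrec.sum_range (Primrec.sum_range h (f := fun p : α × ℕ => N p.1)
    (hN.comp Primrec.fst)) hN

theorem primrecPred_isBalanced (hN : Primrec N) (hK : Primrec K) (hM : Primrec M)
    (hq : Primrec q) (ht : Primrec t) :
    PrimrecPred fun x => IsBalanced (N x) (K x) (M x) (q x) (t x) := by
  have hpow : Primrec fun x => 2 ^ N x := Primrec.nat_pow.comp (Primrec.const 2) hN
  have h : PrimrecPred fun p : ((α × ℕ) × ℕ) × ℕ =>
      (¬ bitCount (N p.1.1.1) p.1.1.2 = K p.1.1.1) ∨ (¬ bitCount (N p.1.1.1) p.1.2 = K p.1.1.1) ∨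
        colorCount (N p.1.1.1) (M p.1.1.1) (t p.1.1.1) p.1.1.2 p.1.2 p.2 ≤ 8 * q p.1.1.1 := by
    have hx : Primrec fun p : ((α × ℕ) × ℕ) × ℕ => p.1.1.1 :=
      Primrec.fst.comp (Primrec.fst.comp Primrec.fst)
    have hA : Primrec fun p : ((α × ℕ) × ℕ) × ℕ => p.1.1.2 :=
      Primrec.snd.comp (Primrec.fst.comp Primrec.fst)
    have hB : Primrec fun p : ((α × ℕ) × ℕ) × ℕ => p.1.2 := Primrec.snd.comp Primrec.fst
    exact (Primrec.eq.comp (primrec_bitCount (hN.comp hx) hA) (hK.comp hx)).not.or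
      ((Primrec.eq.comp (primrec_bitCount (hN.comp hx) hB) (hK.comp hx)).not.or
      (Primrec.nat_le.comp (primrec_colorCount (hN.comp hx) (hM.comp hx) (ht.comp hx) hA hB
        Primrec.snd) (Primrec.nat_mul.comp (Primrec.const 8) (hq.comp hx))))
  have h₁ := h.forall_lt_comp (f := fun p : (α × ℕ) × ℕ => M p.1.1)
    (hM.comp (Primrec.fst.comp Primrec.fst))
  have h₂ := h₁.forall_lt_comp (f := fun p : α × ℕ => 2 ^ N p.1) (hpow.comp Primrec.fst)
  exact (h₂.forall_lt_comp hpow).of_eq fun x =>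
    (isBalanced_iff (N := N x) (K := K x) (M := M x) (q := q x) (t := t x)).symm

end Primrec

theorem le_mul_of_subadditive {N K C : ℕ} {g : Finset ℕ → ℕ} (h₀ : g ∅ = 0)
    (hg : ∀ A A', g (A ∪ A') ≤ g A + g A')
    (h : ∀ A ⊆ range N, #A ≤ K → g A ≤ C) (u : ℕ) :
    ∀ A ⊆ range N, #A ≤ K * u → g A ≤ C * u := by
  induction u with
  | zero =>
    intro A _ hA
    have : A = ∅ := by simpa using hA
    simp [this, h₀]
  | succ u ih =>
    intro A hA hAu
    rw [mul_add, mul_one] at hAu ⊢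
    obtain ⟨A₁, h₁, hc⟩ := exists_subset_card_eq (s := A) (n := min K #A) (min_le_right _ _)
    have h₂ : #(A \ A₁) = #A - min K #A := by rw [card_sdiff_of_subset h₁, hc]
    have := hg (A \ A₁) A₁
    rw [sdiff_union_of_subset h₁] at this
    have h₃ := ih (A \ A₁) (sdiff_subset.trans hA) (by rw [h₂]; omega)
    have h₄ := h A₁ (h₁.trans hA) (by omega)
    omega

theorem le_mul_mul_of_subadditive {N K C : ℕ} {g : Finset ℕ → Finset ℕ → ℕ}
    (h₀ : ∀ B, g ∅ B = 0) (h₀' : ∀ A, g A ∅ = 0)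
    (hg : ∀ A A' B, g (A ∪ A') B ≤ g A B + g A' B) (hg' : ∀ A B B', g A (B ∪ B') ≤ g A B + g A B')
    (h : ∀ A ⊆ range N, ∀ B ⊆ range N, #A ≤ K → #B ≤ K → g A B ≤ C) {A B : Finset ℕ}
    (hA : A ⊆ range N) (hB : B ⊆ range N) {u v : ℕ} (hAu : #A ≤ K * u) (hBv : #B ≤ K * v) :
    g A B ≤ C * u * v := by
  refine le_mul_of_subadditive (h₀' A) (hg' A) (fun B hB hBK => ?_) v B hB hBv
  exact le_mul_of_subadditive (g := fun A => g A B) (h₀ B) (fun A A' => hg A A' B)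
    (fun A hA hAK => h A hA B hB hAK hBK) u A hA hAu

theorem IsBalanced.card_le {N K M q t : ℕ} (ht : IsBalanced N K M q t) (hKN : K ≤ N)
    {A B : Finset ℕ} (hA : A ⊆ range N) (hB : B ⊆ range N) {u v c : ℕ}
    (hAu : #A ≤ K * u) (hBv : #B ≤ K * v) (hc : c < M) :
    #{p ∈ A ×ˢ B | digit M t (p.1 * N + p.2) = c} ≤ 8 * q * u * v := by
  obtain ⟨g, hg⟩ : ∃ g : Finset ℕ → Finset ℕ → ℕ, ∀ A B,
      g A B = #{p ∈ A ×ˢ B | digit M t (p.1 * N + p.2) = c} := ⟨_, fun _ _ => rfl⟩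
  rw [← hg]
  refine le_mul_mul_of_subadditive (N := N) (K := K) (fun B => by simp [hg]) (fun A => by simp [hg])
    (fun A A' B => ?_) (fun A B B' => ?_) (fun A hA B hB hAK hBK => ?_) hA hB hAu hBv
  · rw [hg, hg, hg, union_product, filter_union]
    exact card_union_le _ _
  · rw [hg, hg, hg, product_union, filter_union]
    exact card_union_le _ _
  · obtain ⟨A', hAA, hA', hcA⟩ := exists_subsuperset_card_eq hA hAK (by simpa using hKN)
    obtain ⟨B', hBB, hB', hcB⟩ := exists_subsuperset_card_eq hB hBK (by simpa using hKN)
    rw [hg]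
    exact (Finset.card_le_card (filter_subset_filter _ (product_subset_product hAA hBB))).trans
      (ht A' hA' B' hB' hcA hcB c hc)

end BalancedTable

section Extractor

open Finset

theorem exists_forall_mul_sq_le_two_pow (C : ℕ) :
    ∃ j₀, ∀ j ≥ j₀, C * (j + 1) ^ 2 ≤ 2 ^ j := by
  have h : ∀ j, 10 ≤ j → (j + 1) ^ 3 ≤ 2 * 2 ^ j := by
    intro j hj
    induction j, hj using Nat.le_induction with
    | base => norm_num
    | succ j hj ih =>
      rw [pow_succ 2 j]
      nlinarith [Nat.mul_le_mul hj hj, Nat.mul_le_mul (Nat.mul_le_mul hj hj) hj,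
        Nat.mul_le_mul_left (j ^ 2) hj, Nat.mul_le_mul_left j hj]
  refine ⟨max 10 (2 * C), fun j hj => ?_⟩
  have h₁ := h j (le_of_max_le_left hj)
  have h₂ : 2 * C ≤ j := le_of_max_le_right hj
  have h₃ : 2 * C * (j + 1) ^ 2 ≤ (j + 1) * (j + 1) ^ 2 := Nat.mul_le_mul_right _ (by omega)
  nlinarith

/-- The length of the prefixes of the two sources used at stage `j`. -/
def prefLen (R j : ℕ) : ℕ := 2 ^ (R * j)

/-- The number of bits produced at stage `j`. -/
def stageBits (j : ℕ) : ℕ := 3 * j ^ 2 + 3 * j + 1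

theorem cube_add_stageBits (j : ℕ) : j ^ 3 + stageBits j = (j + 1) ^ 3 := by
  rw [stageBits]; ring

theorem prefLen_mono (R : ℕ) {i j : ℕ} (h : i ≤ j) : prefLen R i ≤ prefLen R j :=
  Nat.pow_le_pow_right two_pos (Nat.mul_le_mul_left R h)

theorem exists_forall_mul_sq_le_prefLen {R : ℕ} (hR : 0 < R) (C : ℕ) :
    ∃ j₀, ∀ j ≥ j₀, C * (j + 1) ^ 2 ≤ prefLen R j := by
  obtain ⟨j₀, h⟩ := exists_forall_mul_sq_le_two_pow C
  exact ⟨j₀, fun j hj => (h j hj).trans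
    (Nat.pow_le_pow_right two_pos (Nat.le_mul_of_pos_left j hR))⟩

/-- The table at stage `j` has balanced colors. -/
def StageBalanced (R j t : ℕ) : Prop :=
  IsBalanced (2 ^ prefLen R (j + 1)) (2 ^ prefLen R j) (2 ^ stageBits j)
    (2 ^ (2 * prefLen R j - stageBits j)) t

open Classical in
/-- The table used at stage `j`, found by exhaustive search. -/
noncomputable def table (R j : ℕ) : ℕ :=
  Nat.findGreatest (StageBalanced R j)
    ((2 ^ stageBits j) ^ (2 ^ prefLen R (j + 1) * 2 ^ prefLen R (j + 1)))

theorem exists_forall_stageBalanced_table {R : ℕ} (hR : 0 < R) :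
    ∃ j₀, ∀ j ≥ j₀, stageBits j ≤ prefLen R j ∧ StageBalanced R j (table R j) := by
  obtain ⟨j₀, h₀⟩ := exists_forall_mul_sq_le_prefLen hR (R + 8)
  refine ⟨j₀, fun j hj => ?_⟩
  have hn : stageBits j + R * (j + 1) + 1 ≤ prefLen R j := by
    refine le_trans ?_ (h₀ j hj)
    rw [stageBits]
    nlinarith [Nat.zero_le (R * j), Nat.zero_le (R * j ^ 2)]
  refine ⟨by omega, ?_⟩
  obtain ⟨t, ht, hb⟩ : ∃ t < (2 ^ stageBits j) ^ (2 ^ prefLen R (j + 1) * 2 ^ prefLen R (j + 1)),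
      StageBalanced R j t := by
    refine exists_isBalanced (by positivity) ?_ ?_
    · rw [← pow_add, ← pow_add]; congr 1; omega
    · generalize hk : prefLen R j = k at *
      generalize hm : stageBits j = m at *
      have hm₁ : 1 ≤ m := by rw [← hm, stageBits]; omega
      generalize hn' : prefLen R (j + 1) = n' at *
      obtain ⟨d, rfl⟩ : ∃ d, k = m + (R * (j + 1) + 1) + d :=
        ⟨k - (m + (R * (j + 1) + 1)), by omega⟩
      set q := 2 ^ (2 * (m + (R * (j + 1) + 1) + d) - m) with hq
      set k := m + (R * (j + 1) + 1) + d with hkd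
      have hq₂ : 2 ^ k * (2 * n') ≤ q := by
        have : 2 * n' = 2 ^ (R * (j + 1) + 1) := by rw [← hn', prefLen, pow_succ, mul_comm]
        rw [this, hq, ← pow_add]
        exact Nat.pow_le_pow_right two_pos (by omega)
      have hq₃ : m ≤ q := by
        calc m ≤ k := by omega
          _ ≤ 2 ^ k := Nat.lt_two_pow_self.le
          _ ≤ q := Nat.pow_le_pow_right two_pos (by omega)
      rw [← pow_mul, ← pow_add, show (4 : ℕ) = 2 ^ 2 by norm_num, ← pow_mul, ← pow_add]
      refine Nat.pow_lt_pow_right (by norm_num) ?_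
      have : n' * (2 * 2 ^ k) = 2 ^ k * (2 * n') := by ring
      omega
  classical
  exact Nat.findGreatest_spec ht.le hb

theorem primrec_prefLen {α : Type*} [Primcodable α] (R : ℕ) {j : α → ℕ} (hj : Primrec j) :
    Primrec fun x => prefLen R (j x) :=
  Primrec.nat_pow.comp (Primrec.const 2) (Primrec.nat_mul.comp (Primrec.const R) hj)

theorem primrec_stageBits {α : Type*} [Primcodable α] {j : α → ℕ} (hj : Primrec j) :
    Primrec fun x => stageBits (j x) :=
  Primrec.nat_add.comp (Primrec.nat_add.comp (Primrec.nat_mul.comp (Primrec.const 3)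
    (Primrec.nat_pow.comp hj (Primrec.const 2))) (Primrec.nat_mul.comp (Primrec.const 3) hj))
    (Primrec.const 1)

theorem primrec_two_pow {α : Type*} [Primcodable α] {j : α → ℕ} (hj : Primrec j) :
    Primrec fun x => 2 ^ j x := Primrec.nat_pow.comp (Primrec.const 2) hj

theorem primrec_table (R : ℕ) : Primrec (table R) := by
  classical
  have hN := primrec_two_pow (primrec_prefLen R (Primrec.succ))
  refine (Primrec.nat_findGreatest (p := StageBalanced R) (Primrec.nat_pow.comp
    (primrec_two_pow (primrec_stageBits Primrec.id)) (Primrec.nat_mul.comp hN hN)) ?_).of_eq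
    fun j => ?_
  · have hj : Primrec fun p : ℕ × ℕ => p.1 := Primrec.fst
    exact primrecPred_isBalanced (primrec_two_pow (primrec_prefLen R (Primrec.succ.comp hj)))
      (primrec_two_pow (primrec_prefLen R hj)) (primrec_two_pow (primrec_stageBits hj))
      (primrec_two_pow (Primrec.nat_sub.comp (Primrec.nat_mul.comp (Primrec.const 2)
        (primrec_prefLen R hj)) (primrec_stageBits hj))) Primrec.snd
  · rw [table]
    rfl

/-- The color assigned at stage `j` to sources with binary expansions `a` and `b`. -/
noncomputable def stageColor (R j a b : ℕ) : ℕ :=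
  digit (2 ^ stageBits j) (table R j)
    (a % 2 ^ prefLen R (j + 1) * 2 ^ prefLen R (j + 1) + b % 2 ^ prefLen R (j + 1))

/-- The first `i ^ 3` output bits on sources with binary expansions `a` and `b`. -/
noncomputable def outVal (R a b : ℕ) : ℕ → ℕ
  | 0 => 0
  | i + 1 => outVal R a b i + 2 ^ (i ^ 3) * stageColor R i a b

theorem stageColor_lt (R j a b : ℕ) : stageColor R j a b < 2 ^ stageBits j :=
  Nat.mod_lt _ (by positivity)

theorem stageColor_mod {R j n a b : ℕ} (h : prefLen R (j + 1) ≤ n) :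
    stageColor R j (a % 2 ^ n) (b % 2 ^ n) = stageColor R j a b := by
  rw [stageColor, stageColor, Nat.mod_mod_of_dvd _ (pow_dvd_pow 2 h),
    Nat.mod_mod_of_dvd _ (pow_dvd_pow 2 h)]

theorem outVal_lt (R a b i : ℕ) : outVal R a b i < 2 ^ (i ^ 3) := by
  induction i with
  | zero => simp [outVal]
  | succ i ih =>
    rw [outVal, ← cube_add_stageBits, pow_add]
    have := stageColor_lt R i a b
    nlinarith

theorem outVal_mod (R a b : ℕ) {i i' : ℕ} (h : i ≤ i') :
    outVal R a b i' % 2 ^ (i ^ 3) = outVal R a b i := by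
  induction i', h using Nat.le_induction with
  | base => exact Nat.mod_eq_of_lt (outVal_lt R a b i)
  | succ j hj ih =>
    obtain ⟨d, hd⟩ := Nat.exists_eq_add_of_le (Nat.pow_le_pow_left hj 3)
    rw [outVal, hd, pow_add, mul_assoc, Nat.add_mul_mod_self_left, ih]

theorem outVal_mod_arg (R a b : ℕ) {i n : ℕ} (h : prefLen R i ≤ n) :
    outVal R (a % 2 ^ n) (b % 2 ^ n) i = outVal R a b i := by
  induction i with
  | zero => rfl
  | succ i ih =>
    rw [outVal, outVal, ih ((prefLen_mono R i.le_succ).trans h), stageColor_mod h]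

section Primrec

variable {α : Type*} [Primcodable α] {a b i : α → ℕ}

theorem primrec_stageColor (R : ℕ) (hi : Primrec i) (ha : Primrec a) (hb : Primrec b) :
    Primrec fun x => stageColor R (i x) (a x) (b x) := by
  have hN := primrec_two_pow (primrec_prefLen R (Primrec.succ.comp hi))
  exact primrec_digit.comp (Primrec.pair (primrec_two_pow (primrec_stageBits hi))
    (Primrec.pair ((primrec_table R).comp hi) (Primrec.nat_add.comp (Primrec.nat_mul.comp
      (Primrec.nat_mod.comp ha hN) hN) (Primrec.nat_mod.comp hb hN))))

theorem primrec_outVal (R : ℕ) (ha : Primrec a) (hb : Primrec b) (hi : Primrec i) :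
    Primrec fun x => outVal R (a x) (b x) (i x) := by
  have step : Primrec₂ fun (x : α) (p : ℕ × ℕ) =>
      p.2 + 2 ^ (p.1 ^ 3) * stageColor R p.1 (a x) (b x) := by
    have hj : Primrec fun y : α × ℕ × ℕ => y.2.1 := Primrec.fst.comp Primrec.snd
    exact Primrec.nat_add.comp (Primrec.snd.comp Primrec.snd) (Primrec.nat_mul.comp
      (primrec_two_pow (Primrec.nat_pow.comp hj (Primrec.const 3)))
      (primrec_stageColor R hj (ha.comp Primrec.fst) (hb.comp Primrec.fst)))
  refine (Primrec.nat_rec' hi (Primrec.const 0) step).of_eq fun x => ?_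
  induction i x with
  | zero => rfl
  | succ j ih => rw [outVal, ← ih]

end Primrec

end Extractor

section Functional

open Finset

theorem length_pre (x : ℕ → Bool) (n : ℕ) : (pre x n).length = n := by simp [pre]

theorem pre_eq_map (x : ℕ → Bool) (n : ℕ) : pre x n = (List.range n).map x := by
  refine List.ext_getElem (by simp [pre]) fun i h₁ h₂ => ?_
  simp [pre]

/-- The number whose binary expansion is the length-`n` prefix of `x`. -/
def seqVal (x : ℕ → Bool) (n : ℕ) : ℕ := strVal (pre x n)

theorem testBit_seqVal {x : ℕ → Bool} {n i : ℕ} (h : i < n) : (seqVal x n).testBit i = x i := by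
  rw [seqVal, testBit_strVal, pre_eq_map, List.getD_eq_getElem?_getD]
  simp [h]

theorem lowBits_seqVal (x : ℕ → Bool) {n n' : ℕ} (h : n ≤ n') :
    lowBits n (seqVal x n') = pre x n := by
  rw [lowBits, pre_eq_map]
  exact List.map_congr_left fun i hi => testBit_seqVal ((List.mem_range.1 hi).trans_le h)

theorem seqVal_mod (x : ℕ → Bool) {n n' : ℕ} (h : n ≤ n') :
    seqVal x n' % 2 ^ n = seqVal x n := by
  rw [← strVal_lowBits, lowBits_seqVal x h, seqVal]

theorem seqVal_lt (x : ℕ → Bool) (n : ℕ) : seqVal x n < 2 ^ n := by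
  simpa only [seqVal, length_pre] using strVal_lt (pre x n)

theorem outVal_seqVal (R : ℕ) (x y : ℕ → Bool) {i n : ℕ} (h : prefLen R i ≤ n) :
    outVal R (seqVal x n) (seqVal y n) i =
      outVal R (seqVal x (prefLen R i)) (seqVal y (prefLen R i)) i := by
  rw [← seqVal_mod x h, ← seqVal_mod y h, outVal_mod_arg R _ _ le_rfl]

/-- The extracted sequence. -/
noncomputable def extract (R : ℕ) (x y : ℕ → Bool) (l : ℕ) : Bool :=
  (outVal R (seqVal x (prefLen R (l + 1))) (seqVal y (prefLen R (l + 1))) (l + 1)).testBit l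

theorem seqVal_extract (R : ℕ) (x y : ℕ → Bool) (i : ℕ) :
    seqVal (extract R x y) (i ^ 3) =
      outVal R (seqVal x (prefLen R i)) (seqVal y (prefLen R i)) i := by
  refine Nat.eq_of_testBit_eq fun l => ?_
  rcases lt_or_ge l (i ^ 3) with hl | hl
  · rw [testBit_seqVal hl, extract]
    have hI₁ : i ≤ max i (l + 1) := le_max_left _ _
    have hI₂ : l + 1 ≤ max i (l + 1) := le_max_right _ _
    generalize max i (l + 1) = I at hI₁ hI₂
    rw [← outVal_seqVal R x y (prefLen_mono R hI₁), ← outVal_seqVal R x y (prefLen_mono R hI₂),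
      ← outVal_mod R _ _ hI₁, ← outVal_mod R _ _ hI₂, Nat.testBit_mod_two_pow,
      Nat.testBit_mod_two_pow]
    have : l < (l + 1) ^ 3 := (Nat.lt_succ_self l).trans_le (Nat.le_self_pow (by norm_num) _)
    simp [hl, this]
  · rw [Nat.testBit_lt_two_pow, Nat.testBit_lt_two_pow]
    · exact (outVal_lt R _ _ i).trans_le (Nat.pow_le_pow_right two_pos hl)
    · exact (seqVal_lt _ _).trans_le (Nat.pow_le_pow_right two_pos hl)

/-- The bits of `w` at the positions `k, k + 2, …, k + 2 * (n - 1)`. -/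
def everySecond (k n : ℕ) (w : Str) : Str := (List.range n).map fun i => w.getD (2 * i + k) false

theorem primrec_everySecond (k : ℕ) : Primrec₂ (everySecond k) :=
  Primrec.list_map (Primrec.list_range.comp Primrec.fst)
    ((Primrec.list_getD false).comp (Primrec.snd.comp Primrec.fst)
      (Primrec.nat_add.comp (Primrec.nat_mul.comp (Primrec.const 2) Primrec.snd)
        (Primrec.const k)))

theorem everySecond_pre {z x : ℕ → Bool} {k n m : ℕ} (hk : k < 2) (hm : 2 * n ≤ m)
    (h : ∀ i, z (2 * i + k) = x i) : everySecond k n (pre z m) = pre x n := by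
  rw [everySecond, pre_eq_map, pre_eq_map]
  refine List.map_congr_left fun i hi => ?_
  have := List.mem_range.1 hi
  have h₁ : 2 * i + k < m := by omega
  simp [List.getD_eq_getElem?_getD, h₁, h]

/-- The functional computing the extracted sequence from the join of the sources. -/
noncomputable def extractor (R : ℕ) (w : Str) (l : ℕ) : Option Bool :=
  if 2 * prefLen R (l + 1) ≤ w.length then
    some ((outVal R (strVal (everySecond 0 (prefLen R (l + 1)) w))
      (strVal (everySecond 1 (prefLen R (l + 1)) w)) (l + 1)).testBit l)
  else none

theorem primrec_extractor (R : ℕ) : Primrec₂ (extractor R) := by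
  have hl : Primrec fun p : Str × ℕ => p.2 + 1 := Primrec.succ.comp Primrec.snd
  have hn := primrec_prefLen R hl
  refine Primrec.ite (Primrec.nat_le.comp (Primrec.nat_mul.comp (Primrec.const 2) hn)
    (Primrec.list_length.comp Primrec.fst)) (Primrec.option_some.comp
    (Primrec.nat_testBit.comp (primrec_outVal R ?_ ?_ hl) Primrec.snd)) (Primrec.const none)
  · exact primrec_strVal.comp ((primrec_everySecond 0).comp hn Primrec.fst)
  · exact primrec_strVal.comp ((primrec_everySecond 1).comp hn Primrec.fst)

theorem partrec_extractor (R : ℕ) :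
    Partrec₂ fun (w : Str) (l : ℕ) => (extractor R w l : Part Bool) :=
  Computable.ofOption (primrec_extractor R).to_comp

theorem turingComputes_extractor (R : ℕ) (x y : ℕ → Bool) :
    TuringComputes (fun w l => (extractor R w l : Part Bool)) (join x y) (extract R x y) := by
  have h : ∀ l m, 2 * prefLen R (l + 1) ≤ m →
      extractor R (pre (join x y) m) l = some (extract R x y l) := by
    intro l m hm
    have hx : ∀ i, join x y (2 * i + 0) = x i := fun i => by simp [join]
    have hy : ∀ i, join x y (2 * i + 1) = y i := fun i => by
      simp [join, Nat.mul_add_div]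
    rw [extractor, length_pre, if_pos hm, everySecond_pre (by norm_num) hm hx,
      everySecond_pre (by norm_num) hm hy]
    rfl
  have h' : ∀ l m b, b ∈ (extractor R (pre (join x y) m) l : Part Bool) →
      b = extract R x y l := by
    intro l m b hb
    rw [Part.mem_coe, Option.mem_def] at hb
    rcases le_or_gt (2 * prefLen R (l + 1)) m with hm | hm
    · rw [h l m hm] at hb
      exact (Option.some_injective _ hb).symm
    · rw [extractor, length_pre, if_neg (by omega)] at hb
      exact absurd hb (by simp)
  refine ⟨fun l m₁ m₂ b₁ b₂ h₁ h₂ => (h' l m₁ b₁ h₁).trans (h' l m₂ b₂ h₂).symm, fun l =>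
    ⟨2 * prefLen R (l + 1), ?_⟩⟩
  simp [h l _ le_rfl]

end Functional

section Counting

open Finset

variable {U : Str × Str →. Str}

/-- Pairs of numbers below `2 ^ prefLen R i` whose successive prefixes have conditional
complexities bounded by `c` and `c'`, and which are mapped to `z` by the extractor. -/
def IsSourcePair (U : Str × Str →. Str) (R : ℕ) (c c' : ℕ → ℕ) (i z : ℕ) (p : ℕ × ℕ) : Prop :=
  (∀ j < i, KC U (lowBits (prefLen R (j + 1)) p.1) (lowBits (prefLen R j) p.1) ≤ c j) ∧
  (∀ j < i, KC U (lowBits (prefLen R (j + 1)) p.2) (lowBits (prefLen R j) p.2) ≤ c' j) ∧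
  outVal R p.1 p.2 i = z

open Classical in
/-- The finite set of source pairs. -/
noncomputable def sourcePairs (U : Str × Str →. Str) (R : ℕ) (c c' : ℕ → ℕ) (i z : ℕ) :
    Finset (ℕ × ℕ) :=
  {p ∈ range (2 ^ prefLen R i) ×ˢ range (2 ^ prefLen R i) | IsSourcePair U R c c' i z p}

open Classical in
/-- The numbers below `2 ^ n` of conditional complexity at most `t` given `u`. -/
noncomputable def simpleExtensions (U : Str × Str →. Str) (n t : ℕ) (u : Str) : Finset ℕ :=
  {a ∈ range (2 ^ n) | KC U (lowBits n a) u ≤ t}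

theorem card_simpleExtensions_le (hU : UniversalM U) (n t : ℕ) (u : Str) :
    #(simpleExtensions U n t u) ≤ 2 ^ (t + 1) := by
  classical
  rw [← card_image_of_injOn (f := lowBits n)]
  · refine card_le_of_forall_KC_le hU (y := u) fun v hv => ?_
    obtain ⟨a, ha, rfl⟩ := mem_image.1 hv
    exact (mem_filter.1 ha).2
  · intro a ha b hb h
    have ha' := mem_range.1 (mem_filter.1 (mem_coe.1 ha)).1
    have hb' := mem_range.1 (mem_filter.1 (mem_coe.1 hb)).1
    have := congrArg strVal h
    rwa [strVal_lowBits, strVal_lowBits, Nat.mod_eq_of_lt ha', Nat.mod_eq_of_lt hb'] at this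

theorem IsSourcePair.mod {R : ℕ} {c c' : ℕ → ℕ} {i z : ℕ} {p : ℕ × ℕ}
    (h : IsSourcePair U R c c' (i + 1) z p) :
    IsSourcePair U R c c' i (z % 2 ^ (i ^ 3))
      (p.1 % 2 ^ prefLen R i, p.2 % 2 ^ prefLen R i) := by
  obtain ⟨h₁, h₂, rfl⟩ := h
  refine ⟨fun j hj => ?_, fun j hj => ?_, ?_⟩
  · rw [lowBits_mod (prefLen_mono R hj), lowBits_mod (prefLen_mono R hj.le)]
    exact h₁ j (by omega)
  · rw [lowBits_mod (prefLen_mono R hj), lowBits_mod (prefLen_mono R hj.le)]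
    exact h₂ j (by omega)
  · rw [outVal_mod_arg R _ _ le_rfl, outVal_mod R _ _ i.le_succ]

theorem card_fiber_le (hU : UniversalM U) {R i n m t t' col : ℕ} (u u' : Str)
    (h : i < m ∨ (stageBits i ≤ prefLen R i ∧ StageBalanced R i (table R i) ∧
      prefLen R i ≤ t + 1 ∧ prefLen R i ≤ t' + 1)) (hn : n = prefLen R (i + 1))
    (hcol : col < 2 ^ stageBits i) :
    #{p ∈ simpleExtensions U n t u ×ˢ simpleExtensions U n t' u' |
        digit (2 ^ stageBits i) (table R i) (p.1 * 2 ^ n + p.2) = col} * 2 ^ stageBits i ≤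
      2 ^ (t + t' + 5 + if i < m then stageBits i else 0) := by
  have hA := card_simpleExtensions_le hU n t u
  have hB := card_simpleExtensions_le hU n t' u'
  by_cases hi : i < m
  · rw [if_pos hi, pow_add _ _ (stageBits i)]
    refine Nat.mul_le_mul_right _ ((card_filter_le _ _).trans ?_)
    rw [card_product]
    calc _ ≤ 2 ^ (t + 1) * 2 ^ (t' + 1) := Nat.mul_le_mul hA hB
      _ ≤ 2 ^ (t + t' + 5) := by
        rw [← pow_add]; exact Nat.pow_le_pow_right two_pos (by omega)
  · obtain ⟨hm, hb, ht, ht'⟩ := h.resolve_left hi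
    have hsplit : ∀ s, prefLen R i ≤ s → 2 ^ s = 2 ^ prefLen R i * 2 ^ (s - prefLen R i) := by
      intro s hs
      rw [← pow_add, Nat.add_sub_cancel' hs]
    have := hb.card_le (A := simpleExtensions U n t u) (B := simpleExtensions U n t' u')
      (Nat.pow_le_pow_right two_pos (prefLen_mono R i.le_succ))
      (hn ▸ filter_subset _ _) (hn ▸ filter_subset _ _)
      (hA.trans_eq (hsplit _ ht)) (hB.trans_eq (hsplit _ ht')) hcol
    rw [← hn] at this
    refine (Nat.mul_le_mul_right _ this).trans_eq ?_
    rw [if_neg hi, show (8 : ℕ) = 2 ^ 3 by norm_num, ← pow_add, ← pow_add, ← pow_add, ← pow_add]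
    congr 1
    omega

theorem card_sourcePairs_succ_le (hU : UniversalM U) {R j₀ : ℕ} {c c' : ℕ → ℕ} {i : ℕ}
    (hj₀ : ∀ j ≥ j₀, stageBits j ≤ prefLen R j ∧ StageBalanced R j (table R j))
    (hc : j₀ ≤ i → prefLen R i ≤ c i + 1) (hc' : j₀ ≤ i → prefLen R i ≤ c' i + 1) (z : ℕ) :
    #(sourcePairs U R c c' (i + 1) z) * 2 ^ stageBits i ≤
      #(sourcePairs U R c c' i (z % 2 ^ (i ^ 3))) *
        2 ^ (c i + c' i + 5 + if i < j₀ then stageBits i else 0) := by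
  classical
  rw [card_eq_sum_card_fiberwise (t := sourcePairs U R c c' i (z % 2 ^ (i ^ 3)))
    (f := fun p => (p.1 % 2 ^ prefLen R i, p.2 % 2 ^ prefLen R i)), sum_mul, ← smul_eq_mul]
  · refine sum_le_card_nsmul _ _ _ fun p₀ _ => ?_
    rcases lt_or_ge (z / 2 ^ (i ^ 3)) (2 ^ stageBits i) with hcol | hcol
    · refine le_trans (Nat.mul_le_mul_right _ (Finset.card_le_card ?_))
        (card_fiber_le hU (R := R) (m := j₀) (lowBits (prefLen R i) p₀.1)
          (lowBits (prefLen R i) p₀.2) ?_ rfl hcol)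
      · rintro ⟨a, b⟩ hp
        simp only [sourcePairs, simpleExtensions, mem_filter, mem_product] at hp ⊢
        obtain ⟨⟨⟨ha, hb⟩, h₁, h₂, h₃⟩, rfl⟩ := hp
        rw [lowBits_mod le_rfl, lowBits_mod le_rfl]
        refine ⟨⟨⟨ha, h₁ i (by omega)⟩, hb, h₂ i (by omega)⟩, ?_⟩
        rw [← h₃, outVal, Nat.add_mul_div_left _ _ (by positivity),
          Nat.div_eq_of_lt (outVal_lt R _ _ i), zero_add, stageColor,
          Nat.mod_eq_of_lt (mem_range.1 ha), Nat.mod_eq_of_lt (mem_range.1 hb)]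
      · rcases lt_or_ge i j₀ with h | h
        · exact Or.inl h
        · exact Or.inr ⟨(hj₀ i h).1, (hj₀ i h).2, hc h, hc' h⟩
    · refine le_of_eq_of_le (mul_eq_zero_of_left (card_eq_zero.2 ?_) _) (Nat.zero_le _)
      refine filter_eq_empty_iff.2 fun p hp => ?_
      obtain ⟨-, -, -, h₃⟩ := mem_filter.1 hp
      have h₄ := outVal_lt R p.1 p.2 (i + 1)
      rw [h₃, ← cube_add_stageBits, pow_add] at h₄
      have := Nat.div_lt_of_lt_mul h₄
      omega
  · intro p hp
    have hp' := mem_filter.1 (mem_coe.1 hp)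
    refine mem_coe.2 (mem_filter.2 ⟨?_, hp'.2.mod⟩)
    simp only [mem_product, mem_range]
    exact ⟨Nat.mod_lt _ (by positivity), Nat.mod_lt _ (by positivity)⟩

theorem card_sourcePairs_le (hU : UniversalM U) {R j₀ : ℕ} {c c' : ℕ → ℕ} {i : ℕ}
    (hj₀ : ∀ j ≥ j₀, stageBits j ≤ prefLen R j ∧ StageBalanced R j (table R j))
    (hc : ∀ j < i, j₀ ≤ j → prefLen R j ≤ c j + 1)
    (hc' : ∀ j < i, j₀ ≤ j → prefLen R j ≤ c' j + 1) (z : ℕ) :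
    #(sourcePairs U R c c' i z) * 2 ^ (i ^ 3) ≤
      2 ^ (∑ j ∈ range i, (c j + c' j) + 5 * i + (min i j₀) ^ 3 + 2) := by
  induction i generalizing z with
  | zero =>
    have : #(sourcePairs U R c c' 0 z) ≤ 4 := by
      classical
      refine (card_filter_le _ _).trans ?_
      simp [prefLen]
    simpa using this
  | succ i ih =>
    have h₁ := card_sourcePairs_succ_le hU hj₀ (hc i (by omega)) (hc' i (by omega)) z
    have h₂ := ih (fun j hj => hc j (by omega)) (fun j hj => hc' j (by omega)) (z % 2 ^ (i ^ 3))
    have h₃ : (min (i + 1) j₀) ^ 3 = (min i j₀) ^ 3 + if i < j₀ then stageBits i else 0 := by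
      split_ifs with h
      · rw [min_eq_left h.le, cube_add_stageBits, min_eq_left h]
      · rw [min_eq_right (by omega), min_eq_right (by omega), add_zero]
    calc #(sourcePairs U R c c' (i + 1) z) * 2 ^ ((i + 1) ^ 3)
        = #(sourcePairs U R c c' (i + 1) z) * 2 ^ stageBits i * 2 ^ (i ^ 3) := by
          rw [← cube_add_stageBits, pow_add]; ring
      _ ≤ _ := Nat.mul_le_mul_right _ h₁
      _ = #(sourcePairs U R c c' i (z % 2 ^ (i ^ 3))) * 2 ^ (i ^ 3) *
            2 ^ (c i + c' i + 5 + if i < j₀ then stageBits i else 0) := by ring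
      _ ≤ _ := Nat.mul_le_mul_right _ h₂
      _ = _ := by
          rw [← pow_add, sum_range_succ, h₃]
          congr 1
          ring

end Counting

section LowerBound

open Finset

variable {U : Str × Str →. Str}

theorem sigmaOne_conditional_le_digit (hU : UniversalM U) (R : ℕ) {α : Type*} [Primcodable α]
    {a i e P : α → ℕ} (ha : Primrec a) (hi : Primrec i) (he : Primrec e) (hP : Primrec P) :
    SigmaOne fun x => ∀ j < i x, KC U (lowBits (prefLen R (j + 1)) (a x))
      (lowBits (prefLen R j) (a x)) ≤ digit (2 ^ e x) (P x) j := by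
  have hx : Primrec fun p : α × ℕ => p.1 := Primrec.fst
  have h := (sigmaOne_KC_le hU).comp (Primrec.pair (primrec_digit.comp (Primrec.pair
    (primrec_two_pow (he.comp hx)) (Primrec.pair (hP.comp hx) Primrec.snd))) (Primrec.pair
    (primrec_lowBits.comp (primrec_prefLen R (Primrec.succ.comp Primrec.snd)) (ha.comp hx))
    (primrec_lowBits.comp (primrec_prefLen R Primrec.snd) (ha.comp hx))))
  exact h.ball_lt hi

/-- The string `u` consists of two prefixes with advice `P` and `P'` that are mapped by the
extractor to the beginning of a string of complexity at most `r`. -/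
def IsSourceString (U : Str × Str →. Str) (R i e r P P' : ℕ) (u : Str) : Prop :=
  ∃ p : (ℕ × ℕ) × Str, (p.1.1 < 2 ^ prefLen R i ∧ p.1.2 < 2 ^ prefLen R i ∧
    u = lowBits (prefLen R i) p.1.1 ++ lowBits (prefLen R i) p.1.2) ∧
    IsSourcePair U R (digit (2 ^ e) P) (digit (2 ^ e) P') i (strVal p.2 % 2 ^ (i ^ 3)) p.1 ∧
    KC U p.2 [] ≤ r

theorem sigmaOne_isSourceString (hU : UniversalM U) (R : ℕ) :
    SigmaOne fun a : (ℕ × ℕ × ℕ × ℕ × ℕ) × Str × Str =>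
      IsSourceString U R a.1.1 a.1.2.1 a.1.2.2.1 a.1.2.2.2.1 a.1.2.2.2.2 a.2.2 := by
  let β := ((ℕ × ℕ × ℕ × ℕ × ℕ) × Str × Str) × ((ℕ × ℕ) × Str)
  have hpar : Primrec fun x : β => x.1.1 := Primrec.fst.comp Primrec.fst
  have hu : Primrec fun x : β => x.1.2.2 := Primrec.snd.comp (Primrec.snd.comp Primrec.fst)
  have hi : Primrec fun x : β => x.1.1.1 := Primrec.fst.comp hpar
  have h₂ : Primrec fun x : β => x.1.1.2 := Primrec.snd.comp hpar
  have he : Primrec fun x : β => x.1.1.2.1 := Primrec.fst.comp h₂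
  have h₃ : Primrec fun x : β => x.1.1.2.2 := Primrec.snd.comp h₂
  have hr : Primrec fun x : β => x.1.1.2.2.1 := Primrec.fst.comp h₃
  have h₄ : Primrec fun x : β => x.1.1.2.2.2 := Primrec.snd.comp h₃
  have hP : Primrec fun x : β => x.1.1.2.2.2.1 := Primrec.fst.comp h₄
  have hP' : Primrec fun x : β => x.1.1.2.2.2.2 := Primrec.snd.comp h₄
  have ha : Primrec fun x : β => x.2.1.1 := Primrec.fst.comp (Primrec.fst.comp Primrec.snd)
  have hb : Primrec fun x : β => x.2.1.2 := Primrec.snd.comp (Primrec.fst.comp Primrec.snd)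
  have hg : Primrec fun x : β => x.2.2 := Primrec.snd.comp Primrec.snd
  have hn := primrec_prefLen R hi
  have hout : PrimrecPred fun x : β => outVal R x.2.1.1 x.2.1.2 x.1.1.1 =
      strVal x.2.2 % 2 ^ (x.1.1.1 ^ 3) :=
    Primrec.eq.comp (primrec_outVal R ha hb hi) (Primrec.nat_mod.comp (primrec_strVal.comp hg)
      (primrec_two_pow (Primrec.nat_pow.comp hi (Primrec.const 3))))
  have hran : PrimrecPred fun x : β => x.2.1.1 < 2 ^ prefLen R x.1.1.1 ∧
      x.2.1.2 < 2 ^ prefLen R x.1.1.1 ∧ x.1.2.2 =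
        lowBits (prefLen R x.1.1.1) x.2.1.1 ++ lowBits (prefLen R x.1.1.1) x.2.1.2 :=
    (Primrec.nat_lt.comp ha (primrec_two_pow hn)).and ((Primrec.nat_lt.comp hb
      (primrec_two_pow hn)).and (Primrec.eq.comp hu (Primrec.list_append.comp
        (primrec_lowBits.comp hn ha) (primrec_lowBits.comp hn hb))))
  have hKC : SigmaOne fun x : β => KC U x.2.2 [] ≤ x.1.1.2.2.1 :=
    (sigmaOne_KC_le hU).comp (hr.pair (hg.pair (Primrec.const [])))
  exact ((SigmaOne.of_primrecPred hran).and (((sigmaOne_conditional_le_digit hU R ha hi he hP).and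
    ((sigmaOne_conditional_le_digit hU R hb hi he hP').and (SigmaOne.of_primrecPred hout))).and
      hKC)).ex

theorem card_sourceStrings_le (hU : UniversalM U) {R j₀ i e r P P' : ℕ}
    (hj₀ : ∀ j ≥ j₀, stageBits j ≤ prefLen R j ∧ StageBalanced R j (table R j))
    (hP : ∀ j < i, j₀ ≤ j → prefLen R j ≤ digit (2 ^ e) P j + 1)
    (hP' : ∀ j < i, j₀ ≤ j → prefLen R j ≤ digit (2 ^ e) P' j + 1)
    {F : Finset Str} (hF : ∀ v ∈ F, IsSourceString U R i e r P P' v) :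
    #F * 2 ^ (i ^ 3) ≤ 2 ^ (r + ∑ j ∈ range i, (digit (2 ^ e) P j + digit (2 ^ e) P' j) + 5 * i +
      j₀ ^ 3 + 3) := by
  classical
  choose! p hp using hF
  set c := digit (2 ^ e) P
  set c' := digit (2 ^ e) P'
  set G := F.image fun v => (p v).2
  have hG : #G ≤ 2 ^ (r + 1) := card_le_of_forall_KC_le hU (y := []) fun g hg => by
    obtain ⟨v, hv, rfl⟩ := mem_image.1 hg
    exact (hp v hv).2.2
  have hsub : F ⊆ (G.biUnion fun g => sourcePairs U R c c' i (strVal g % 2 ^ (i ^ 3))).image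
      fun q => lowBits (prefLen R i) q.1 ++ lowBits (prefLen R i) q.2 := by
    intro v hv
    obtain ⟨⟨ha, hb, hu⟩, hs, -⟩ := hp v hv
    refine mem_image.2 ⟨(p v).1, mem_biUnion.2 ⟨(p v).2, mem_image_of_mem _ hv, ?_⟩, hu.symm⟩
    exact mem_filter.2 ⟨mem_product.2 ⟨mem_range.2 ha, mem_range.2 hb⟩, hs⟩
  set E := ∑ j ∈ range i, (c j + c' j) + 5 * i + (min i j₀) ^ 3 + 2 with hE
  have hmin : (min i j₀) ^ 3 ≤ j₀ ^ 3 := Nat.pow_le_pow_left (min_le_right _ _) 3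
  calc #F * 2 ^ (i ^ 3)
      ≤ (∑ g ∈ G, #(sourcePairs U R c c' i (strVal g % 2 ^ (i ^ 3)))) * 2 ^ (i ^ 3) :=
        Nat.mul_le_mul_right _ ((Finset.card_le_card hsub).trans
          (card_image_le.trans card_biUnion_le))
    _ = ∑ g ∈ G, #(sourcePairs U R c c' i (strVal g % 2 ^ (i ^ 3))) * 2 ^ (i ^ 3) := sum_mul _ _ _
    _ ≤ #G * 2 ^ E := by
        rw [← smul_eq_mul]
        exact sum_le_card_nsmul _ _ _ fun g _ => card_sourcePairs_le hU hj₀ hP hP' _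
    _ ≤ 2 ^ (r + 1) * 2 ^ E := Nat.mul_le_mul_right _ hG
    _ ≤ _ := by
        rw [← pow_add]
        exact Nat.pow_le_pow_right two_pos (by omega)

theorem exists_KC_append_add_cube_le (hU : UniversalM U) {R j₀ : ℕ}
    (hj₀ : ∀ j ≥ j₀, stageBits j ≤ prefLen R j ∧ StageBalanced R j (table R j)) :
    ∃ d, ∀ i e r P P' f u, i < 2 ^ f → e < 2 ^ f → r < 2 ^ f → P < 2 ^ f → P' < 2 ^ f →
      (∀ j < i, j₀ ≤ j → prefLen R j ≤ digit (2 ^ e) P j + 1) →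
      (∀ j < i, j₀ ≤ j → prefLen R j ≤ digit (2 ^ e) P' j + 1) →
      IsSourceString U R i e r P P' u →
      KC U u [] + i ^ 3 ≤
        r + ∑ j ∈ range i, (digit (2 ^ e) P j + digit (2 ^ e) P' j) + 5 * i + 32 * f + d := by
  obtain ⟨d, hd⟩ := KC_le_of_sigmaOne_five hU (sigmaOne_isSourceString hU R)
  refine ⟨d + j₀ ^ 3 + 3, fun i e r P P' f u h₁ h₂ h₃ h₄ h₅ hP hP' hu => ?_⟩
  have hcard := fun F => card_sourceStrings_le hU (F := F) (r := r) hj₀ hP hP'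
  set E := r + ∑ j ∈ range i, (digit (2 ^ e) P j + digit (2 ^ e) P' j) + 5 * i + j₀ ^ 3 + 3
  have hE : i ^ 3 ≤ E := by
    have := hcard {u} (by simpa using hu)
    rw [card_singleton, one_mul] at this
    exact (Nat.pow_le_pow_iff_right (by norm_num)).1 this
  have := hd i e r P P' f (E - i ^ 3) [] u h₁ h₂ h₃ h₄ h₅ hu fun F hF => by
    have := hcard F hF
    rw [← Nat.sub_add_cancel hE, pow_add] at this
    exact Nat.le_of_mul_le_mul_right this (by positivity)
  omega

end LowerBound

section SequenceBound

open Finset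

variable {U : Str × Str →. Str}

/-- The complexity of the stage-`j + 1` prefix of `x` given its stage-`j` prefix. -/
noncomputable def stepKC (U : Str × Str →. Str) (R : ℕ) (x : ℕ → Bool) (j : ℕ) : ℕ :=
  KC U (pre x (prefLen R (j + 1))) (pre x (prefLen R j))

theorem exists_sum_stepKC_le (hU : UniversalM U) {R : ℕ} (hR : 0 < R) :
    ∃ d, ∀ (x : ℕ → Bool) (i : ℕ), ∑ j ∈ range i, stepKC U R x j ≤
      KC0 U (pre x (prefLen R i)) + d * (i + 1) ^ 2 := by
  obtain ⟨c, hc⟩ := exists_KC_prefix_add_KC_le hU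
  refine ⟨64 * R + 64 + c, fun x i => ?_⟩
  have h : ∀ i, ∑ j ∈ range i, stepKC U R x j ≤
      KC0 U (pre x (prefLen R i)) + ∑ j ∈ range i, (64 * (R * (j + 1) + 1) + c) := by
    intro i
    induction i with
    | zero => simp
    | succ i ih =>
      have h₁ := hc (prefLen R i) (prefLen R (i + 1)) (seqVal x (prefLen R (i + 1)))
        (R * (i + 1) + 1) (prefLen_mono R i.le_succ)
        (Nat.pow_lt_pow_right (by norm_num) (Nat.lt_succ_self _))
      rw [lowBits_seqVal x le_rfl, lowBits_seqVal x (prefLen_mono R i.le_succ)] at h₁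
      rw [sum_range_succ, sum_range_succ]
      simp only [stepKC, KC0] at ih ⊢
      omega
  refine (h i).trans (Nat.add_le_add_left ?_ _)
  have h₂ : ∑ j ∈ range i, (64 * (R * (j + 1) + 1) + c) ≤
      ∑ j ∈ range i, (64 * R + 64 + c) * (i + 1) := by
    refine sum_le_sum fun j hj => ?_
    have := mem_range.1 hj
    have h₃ : R * (j + 1) ≤ R * (i + 1) := Nat.mul_le_mul_left _ (by omega)
    nlinarith
  refine h₂.trans ?_
  rw [sum_const, card_range, smul_eq_mul]
  nlinarith

theorem exists_stepKC_lt (hU : UniversalM U) (R : ℕ) :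
    ∃ d, ∀ (x : ℕ → Bool) (i j : ℕ), j < i → stepKC U R x j < 2 ^ (R * i + d) := by
  obtain ⟨c, hc⟩ := KC_le_length hU
  refine ⟨c + 1, fun x i j hj => ?_⟩
  have h := hc (pre x (prefLen R (j + 1))) (pre x (prefLen R j))
  rw [length_pre] at h
  have h₁ := prefLen_mono R (show j + 1 ≤ i from hj)
  have h₂ : c + 1 ≤ 2 ^ c := Nat.lt_two_pow_self
  have h₃ : 1 ≤ 2 ^ (R * i) := Nat.one_le_two_pow
  rw [stepKC, pow_add, pow_succ]
  simp only [prefLen] at h h₁ ⊢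
  nlinarith

theorem CIndependent.exists_le {x y : ℕ → Bool} (h : CIndependent U x y) (R : ℕ) :
    ∃ d : ℕ, ∀ i, KC0 U (pre x (prefLen R i)) + KC0 U (pre y (prefLen R i)) ≤
      KC0 U (pre x (prefLen R i) ++ pre y (prefLen R i)) + d * (i + 1) := by
  obtain ⟨c, hc⟩ := h
  refine ⟨⌈|c|⌉₊ * (2 * R + 1), fun i => ?_⟩
  have h₁ := hc (prefLen R i) (prefLen R i)
  have hlog : Real.logb 2 (prefLen R i : ℕ) = R * i := by
    rw [prefLen]
    push_cast
    rw [← Nat.cast_mul, ← Real.rpow_natCast, Real.logb_rpow (by norm_num) (by norm_num)]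
  rw [hlog] at h₁
  have h₂ : |c| ≤ ⌈|c|⌉₊ := Nat.le_ceil _
  generalize (⌈|c|⌉₊) = k at h₂ ⊢
  have h₃ : c * (R * i + R * i) + c ≤ k * (2 * R + 1) * (i + 1) := by
    have h₄ : c ≤ k := (le_abs_self c).trans h₂
    have h₅ : (0 : ℝ) ≤ R * i := by positivity
    have h₆ : (0 : ℝ) ≤ k := by positivity
    calc c * (R * i + R * i) + c ≤ k * (R * i + R * i) + k := by gcongr
      _ ≤ k * (R * i + R * i) + k + (k * (2 * R) + k * i) := by
        have : (0 : ℝ) ≤ k * (2 * R) + k * i := by positivity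
        linarith
      _ = k * (2 * R + 1) * (i + 1) := by ring
  have : (KC0 U (pre x (prefLen R i)) : ℝ) + KC0 U (pre y (prefLen R i)) ≤
      KC0 U (pre x (prefLen R i) ++ pre y (prefLen R i)) + k * (2 * R + 1) * (i + 1) := by
    linarith
  exact_mod_cast this

theorem exists_cube_le_KC_extract (hU : UniversalM U) {R j₀ : ℕ} (hR : 0 < R)
    (hj₀ : ∀ j ≥ j₀, stageBits j ≤ prefLen R j ∧ StageBalanced R j (table R j))
    {x y : ℕ → Bool} (hxy : CIndependent U x y)
    (hx : ∀ j ≥ j₀, prefLen R j ≤ stepKC U R x j + 1)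
    (hy : ∀ j ≥ j₀, prefLen R j ≤ stepKC U R y j + 1) :
    ∃ D, ∀ i n, i ^ 3 ≤ n → i ^ 3 ≤ KC0 U (pre (extract R x y) n) + D * (i + 1) ^ 2 := by
  obtain ⟨d₁, h₁⟩ := exists_KC_append_add_cube_le hU hj₀
  obtain ⟨d₂, h₂⟩ := exists_sum_stepKC_le hU hR
  obtain ⟨d₃, h₃⟩ := exists_stepKC_lt hU R
  obtain ⟨d₄, h₄⟩ := hxy.exists_le R
  refine ⟨d₁ + 2 * d₂ + d₄ + 5 + 96 * (R + d₃), fun i n hin => ?_⟩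
  set r := KC0 U (pre (extract R x y) n) with hr
  rcases le_or_gt (i ^ 3) r with hri | hri
  · omega
  set e := R * i + d₃ with he
  have hie : i ≤ e := (Nat.le_mul_of_pos_left i hR).trans (Nat.le_add_right _ _)
  obtain ⟨P, hP, hPd⟩ := exists_digit_eq i (stepKC U R x) (fun j hj => h₃ x i j hj)
  obtain ⟨P', hP', hPd'⟩ := exists_digit_eq i (stepKC U R y) (fun j hj => h₃ y i j hj)
  rw [← he] at hP hP' hPd hPd'
  rw [← pow_mul] at hP hP'
  set f := e * (i + 3) with hf
  have hef : e ≤ f := Nat.le_mul_of_pos_right e (by omega)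
  have he_lt : e < 2 ^ e := Nat.lt_two_pow_self
  have hpow : 2 ^ e ≤ 2 ^ f := Nat.pow_le_pow_right two_pos hef
  have hrf : r < 2 ^ f := by
    calc r < i ^ 3 := hri
      _ ≤ (2 ^ e) ^ 3 := Nat.pow_le_pow_left (hie.trans he_lt.le) 3
      _ = 2 ^ (e * 3) := (pow_mul _ _ _).symm
      _ ≤ 2 ^ f := Nat.pow_le_pow_right two_pos (Nat.mul_le_mul_left e (by omega))
  have hPf : 2 ^ (e * i) ≤ 2 ^ f :=
    Nat.pow_le_pow_right two_pos (Nat.mul_le_mul_left e (by omega))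
  have hs : IsSourceString U R i e r P P' (pre x (prefLen R i) ++ pre y (prefLen R i)) := by
    refine ⟨((seqVal x (prefLen R i), seqVal y (prefLen R i)), pre (extract R x y) n),
      ⟨seqVal_lt _ _, seqVal_lt _ _, ?_⟩, ⟨fun j hj => ?_, fun j hj => ?_, ?_⟩, hr.ge⟩
    · rw [lowBits_seqVal x le_rfl, lowBits_seqVal y le_rfl]
    · rw [lowBits_seqVal x (prefLen_mono R hj), lowBits_seqVal x (prefLen_mono R hj.le), hPd j hj,
        stepKC]
    · rw [lowBits_seqVal y (prefLen_mono R hj), lowBits_seqVal y (prefLen_mono R hj.le), hPd' j hj,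
        stepKC]
    · rw [← seqVal_extract, ← seqVal_mod _ hin, seqVal]
  have key := h₁ i e r P P' f _ ((hie.trans_lt he_lt).trans_le hpow) (he_lt.trans_le hpow) hrf
    (hP.trans_le hPf) (hP'.trans_le hPf) (fun j hj hj' => by rw [hPd j hj]; exact hx j hj')
    (fun j hj hj' => by rw [hPd' j hj]; exact hy j hj') hs
  rw [sum_add_distrib, sum_congr rfl fun j hj => hPd j (mem_range.1 hj),
    sum_congr rfl fun j hj => hPd' j (mem_range.1 hj)] at key
  have hx₂ : (range i).sum (stepKC U R x) ≤ _ := h₂ x i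
  have hy₂ : (range i).sum (stepKC U R y) ≤ _ := h₂ y i
  have hxy₂ := h₄ i
  rw [KC0] at hxy₂ hx₂ hy₂
  rw [KC0, KC0] at hxy₂
  have hf₂ : 32 * f ≤ 96 * (R + d₃) * (i + 1) ^ 2 := by
    have : e ≤ (R + d₃) * (i + 1) := by rw [he]; nlinarith
    calc 32 * f ≤ 32 * ((R + d₃) * (i + 1) * (3 * (i + 1))) := by
          rw [hf]; exact Nat.mul_le_mul_left _ (Nat.mul_le_mul this (by omega))
      _ = _ := by ring
  have hsq : i + 1 ≤ (i + 1) ^ 2 := Nat.le_self_pow (by norm_num) _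
  have : d₄ * (i + 1) ≤ d₄ * (i + 1) ^ 2 := Nat.mul_le_mul_left _ hsq
  have : d₁ ≤ d₁ * (i + 1) ^ 2 := Nat.le_mul_of_pos_right _ (by positivity)
  have : (d₁ + 2 * d₂ + d₄ + 5 + 96 * (R + d₃)) * (i + 1) ^ 2 = d₁ * (i + 1) ^ 2 +
    2 * (d₂ * (i + 1) ^ 2) + d₄ * (i + 1) ^ 2 + 5 * (i + 1) ^ 2 + 96 * (R + d₃) * (i + 1) ^ 2 := by
    ring
  omega

end SequenceBound

section Dimension

open Filter Topology

variable {U : Str × Str →. Str}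

theorem exists_forall_mul_le_KC0 {x : ℕ → Bool} {s : ℝ} (hs : s < dimOf U x) :
    ∃ n₀, ∀ n ≥ n₀, s * n ≤ KC0 U (pre x n) := by
  have hb : IsBoundedUnder (· ≥ ·) atTop fun n : ℕ => (KC0 U (pre x n) : ℝ) / (n : ℝ) :=
    isBoundedUnder_of ⟨0, fun n => by positivity⟩
  obtain ⟨n₀, h⟩ := eventually_atTop.1 (eventually_lt_of_lt_liminf hs hb)
  refine ⟨n₀, fun n hn => ?_⟩
  rcases Nat.eq_zero_or_pos n with rfl | hpos
  · simp
  · exact ((lt_div_iff₀ (by exact_mod_cast hpos)).1 (h n hn)).le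

theorem exists_forall_prefLen_le_stepKC (hU : UniversalM U) {R : ℕ} (hR : 0 < R) {s : ℝ}
    (hs : 64 ≤ s * 2 ^ R) {x : ℕ → Bool} (hx : s < dimOf U x) :
    ∃ j₀, ∀ j ≥ j₀, prefLen R j ≤ stepKC U R x j + 1 := by
  obtain ⟨n₀, hn₀⟩ := exists_forall_mul_le_KC0 hx
  obtain ⟨c, hc⟩ := exists_KC_le_KC_prefix hU
  obtain ⟨d, hd⟩ := exists_stepKC_lt hU R
  obtain ⟨j₀, hj₀⟩ := exists_forall_mul_sq_le_prefLen hR (R + d + c + n₀)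
  refine ⟨j₀, fun j hj => ?_⟩
  have hbig := hj₀ j hj
  have hsq : R * (j + 1) + d + c + n₀ ≤ prefLen R j := by
    have h₁ : j + 1 ≤ (j + 1) ^ 2 := Nat.le_self_pow (by norm_num) _
    have h₂ : 1 ≤ (j + 1) ^ 2 := Nat.one_le_pow _ _ (by omega)
    nlinarith [Nat.mul_le_mul_left R h₁, Nat.mul_le_mul_left (d + c + n₀) h₂]
  have hlt : stepKC U R x j < 2 ^ prefLen R j :=
    (hd x (j + 1) j (by omega)).trans_le (Nat.pow_le_pow_right two_pos (by omega))
  have hup := hc (prefLen R j) _ (seqVal x (prefLen R (j + 1))) (pre x (prefLen R (j + 1)))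
    (prefLen R j) le_rfl hlt (by rw [lowBits_seqVal x (prefLen_mono R j.le_succ), stepKC])
  have hlow := hn₀ (prefLen R (j + 1)) (by
    have : prefLen R j ≤ prefLen R (j + 1) := prefLen_mono R j.le_succ
    omega)
  have hpow : (prefLen R (j + 1) : ℝ) = 2 ^ R * prefLen R j := by
    simp only [prefLen, Nat.cast_pow, Nat.cast_ofNat]
    rw [← pow_add]
    ring
  have h₁ : (64 : ℝ) * prefLen R j ≤ KC0 U (pre x (prefLen R (j + 1))) := by
    rw [hpow, ← mul_assoc] at hlow
    exact (mul_le_mul_of_nonneg_right hs (Nat.cast_nonneg _)).trans hlow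
  have h₂ : 64 * prefLen R j ≤ KC0 U (pre x (prefLen R (j + 1))) := by exact_mod_cast h₁
  rw [KC0] at h₂
  omega

theorem dimOf_eq_one (hU : UniversalM U) {z : ℕ → Bool} {D : ℕ}
    (h : ∀ i n, i ^ 3 ≤ n → i ^ 3 ≤ KC0 U (pre z n) + D * (i + 1) ^ 2) : dimOf U z = 1 := by
  refine Tendsto.liminf_eq ?_
  obtain ⟨c, hc⟩ := KC_le_length hU
  have hroot : Tendsto (fun n : ℕ => (n : ℝ) ^ (1 / 3 : ℝ)) atTop atTop :=
    (tendsto_rpow_atTop (by norm_num)).comp tendsto_natCast_atTop_atTop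
  have hlow : Tendsto (fun n : ℕ => 1 - (3 + 4 * D : ℝ) / (n : ℝ) ^ (1 / 3 : ℝ)) atTop (𝓝 1) := by
    simpa using (hroot.const_div_atTop (3 + 4 * D : ℝ)).const_sub 1
  have hup : Tendsto (fun n : ℕ => 1 + (c : ℝ) / (n : ℝ)) atTop (𝓝 1) := by
    simpa using (tendsto_const_div_atTop_nhds_zero_nat (c : ℝ)).const_add 1
  refine tendsto_of_tendsto_of_tendsto_of_le_of_le' hlow hup ?_ ?_
  · filter_upwards [eventually_ge_atTop 1] with n hn
    have hn' : (1 : ℝ) ≤ n := by exact_mod_cast hn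
    set t : ℝ := (n : ℝ) ^ (1 / 3 : ℝ) with ht
    have ht₁ : 1 ≤ t := Real.one_le_rpow hn' (by norm_num)
    have ht₃ : t ^ 3 = n := by
      rw [ht, ← Real.rpow_natCast, ← Real.rpow_mul (by positivity)]
      norm_num
    have hi₁ : (⌊t⌋₊ : ℝ) ≤ t := Nat.floor_le (by linarith)
    have hi₂ : t < ⌊t⌋₊ + 1 := Nat.lt_floor_add_one t
    generalize ⌊t⌋₊ = i at hi₁ hi₂
    have hin : i ^ 3 ≤ n := by
      have : (i : ℝ) ^ 3 ≤ n := ht₃ ▸ pow_le_pow_left₀ (by positivity) hi₁ 3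
      exact_mod_cast this
    have hK : (i : ℝ) ^ 3 ≤ KC0 U (pre z n) + D * (i + 1) ^ 2 := by exact_mod_cast h i n hin
    have h₁ : (t - 1) ^ 3 ≤ (i : ℝ) ^ 3 := pow_le_pow_left₀ (by linarith) (by linarith) 3
    have h₂ : (D : ℝ) * (i + 1) ^ 2 ≤ D * (2 * t) ^ 2 := by
      gcongr
      linarith
    rw [le_div_iff₀ (by linarith), ← ht₃]
    have h₃ : (1 - (3 + 4 * D : ℝ) / t) * t ^ 3 = t ^ 3 - (3 + 4 * D) * t ^ 2 := by
      field_simp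
    rw [h₃]
    nlinarith
  · filter_upwards [eventually_ge_atTop 1] with n hn
    have hn' : (1 : ℝ) ≤ n := by exact_mod_cast hn
    have : (KC0 U (pre z n) : ℝ) ≤ n + c := by
      have := hc (pre z n) []
      rw [length_pre] at this
      exact_mod_cast this
    rw [div_le_iff₀ (by linarith), add_mul, div_mul_cancel₀ _ (by linarith)]
    linarith

end Dimension

/-- there is a single oracle Turing machine extracting a sequence of
effective Hausdorff dimension `1` from any two C-independent sequences of
dimension at least `σ`. -/
theorem stmt16 (U : Str × Str →. Str) (hU : UniversalM U) (σ : ℚ) (hσ : 0 < σ) :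
    ∃ Φ : Str → ℕ →. Bool, Partrec₂ Φ ∧
      ∀ x y : ℕ → Bool, CIndependent U x y →
        (σ : ℝ) ≤ dimOf U x → (σ : ℝ) ≤ dimOf U y →
        ∃ B : ℕ → Bool, TuringComputes Φ (join x y) B ∧ dimOf U B = 1 := by
  have hσ' : (0 : ℝ) < σ := by exact_mod_cast hσ
  obtain ⟨k, hk⟩ := pow_unbounded_of_one_lt (128 / (σ : ℝ)) one_lt_two
  have hR : 64 ≤ (σ / 2 : ℝ) * 2 ^ (k + 1) := by
    rw [div_lt_iff₀ hσ'] at hk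
    rw [pow_succ]
    linarith
  refine ⟨fun w l => (extractor (k + 1) w l : Part Bool), partrec_extractor (k + 1),
    fun x y hxy hx hy => ⟨extract (k + 1) x y, turingComputes_extractor (k + 1) x y, ?_⟩⟩
  obtain ⟨j₁, h₁⟩ := exists_forall_stageBalanced_table (Nat.succ_pos k)
  obtain ⟨j₂, h₂⟩ := exists_forall_prefLen_le_stepKC hU (Nat.succ_pos k) hR
    (show (σ / 2 : ℝ) < dimOf U x by linarith)
  obtain ⟨j₃, h₃⟩ := exists_forall_prefLen_le_stepKC hU (Nat.succ_pos k) hR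
    (show (σ / 2 : ℝ) < dimOf U y by linarith)
  obtain ⟨D, hD⟩ := exists_cube_le_KC_extract hU (j₀ := j₁ + j₂ + j₃) (Nat.succ_pos k)
    (fun j hj => h₁ j (by omega)) hxy (fun j hj => h₂ j (by omega)) fun j hj => h₃ j (by omega)
  exact dimOf_eq_one hU hD
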